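/- Let n ≥ 3. Let μ be the Haar measure on G = SL_n(ℝ) normalized so that a (equivalently, every) measurable fundamental domain ℱ ⊂ G for the left action of Γ = SL_n(ℤ) satisfies μ(ℱ) = 1. Then there exists a constant C_n > 0 such that for every measurable fundamental domain ℱ and every bounded measurable set A ⊂ ℝⁿ with vol(A) > 1: ∫_ℱ D(ℤⁿg, A)² dμ(g) ≤ C_n · vol(A). -/

import Mathlib

open MeasureTheory Matrix

noncomputable section

/-- `SL_n(ℝ)`. -/
abbrev SLR (n : ℕ) := Matrix.SpecialLinearGroup (Fin n) ℝ

instance (n : ℕ) : TopologicalSpace (SLR n) :=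
  TopologicalSpace.induced (fun g => (g : Matrix (Fin n) (Fin n) ℝ)) inferInstance

instance (n : ℕ) : MeasurableSpace (SLR n) := borel _

/-- `Γ = SL_n(ℤ)`, viewed as a subgroup of `SL_n(ℝ)`. -/
def Gam (n : ℕ) : Subgroup (SLR n) :=
  MonoidHom.range (Matrix.SpecialLinearGroup.map (n := Fin n) (Int.castRingHom ℝ))

/-- The coercion `ℤⁿ → ℝⁿ`. -/
def intVec {n : ℕ} (v : Fin n → ℤ) : Fin n → ℝ := fun i => (v i : ℝ)

/-- Number of points of the lattice `ℤⁿg` lying in `A`. -/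
def latCount {n : ℕ} (g : SLR n) (A : Set (Fin n → ℝ)) : ℕ :=
  Nat.card {v : Fin n → ℤ |
    Matrix.vecMul (intVec v) (g : Matrix (Fin n) (Fin n) ℝ) ∈ A}

/-- The discrepancy `D(ℤⁿg, A) = |#(ℤⁿg ∩ A) − vol(A)|`. -/
def disc {n : ℕ} (g : SLR n) (A : Set (Fin n → ℝ)) : ℝ :=
  |(latCount g A : ℝ) - (volume A).toReal|

instance (n : ℕ) : BorelSpace (SLR n) := ⟨rfl⟩

lemma continuous_coe_SLR (n : ℕ) :
    Continuous fun g : SLR n => (g : Matrix (Fin n) (Fin n) ℝ) :=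
  continuous_induced_dom

instance (n : ℕ) : SecondCountableTopology (SLR n) :=
  haveI : SecondCountableTopology (Matrix (Fin n) (Fin n) ℝ) :=
    inferInstanceAs (SecondCountableTopology (Fin n → Fin n → ℝ))
  Topology.IsInducing.secondCountableTopology (f := fun g : SLR n => (g : Matrix (Fin n) (Fin n) ℝ))
    ⟨rfl⟩

instance (n : ℕ) : ContinuousMul (SLR n) where
  continuous_mul := by
    refine continuous_induced_rng.2 ?_
    exact ((continuous_coe_SLR n).comp continuous_fst).mul ((continuous_coe_SLR n).comp continuous_snd)

instance (n : ℕ) : MeasurableConstSMul (Gam n) (SLR n) where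
  measurable_const_smul γ := by
    change Measurable fun g : SLR n => (γ : SLR n) * g
    exact measurable_const_mul _

instance (n : ℕ) : Countable (Matrix.SpecialLinearGroup (Fin n) ℤ) :=
  haveI : Countable (Matrix (Fin n) (Fin n) ℤ) :=
    inferInstanceAs (Countable (Fin n → Fin n → ℤ))
  Subtype.countable

instance (n : ℕ) : Countable (Gam n) :=
  (MonoidHom.rangeRestrict_surjective
    (Matrix.SpecialLinearGroup.map (n := Fin n) (Int.castRingHom ℝ))).countable

/-- If the translates `γ * h a` are, up to reindexing, the translates `k b * γ`, then
averaging a `Γ`-invariant function along the `h a` preserves its integral over a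
fundamental domain. -/
lemma sum_setLIntegral_mul_left {G : Type*} [Group G] [MeasurableSpace G] [MeasurableMul G]
    (Γ : Subgroup G) [Countable Γ] (μ : Measure G) [μ.IsMulLeftInvariant]
    [MeasurableConstSMul Γ G] {F : Set G} (hF : IsFundamentalDomain Γ F μ)
    {P : Type*} [Fintype P] (h k : P → G) (σ : P × Γ ≃ P × Γ)
    (hσ : ∀ x, (x.2 : G) * h x.1 = k (σ x).1 * ((σ x).2 : G))
    (Φ : G → ENNReal) (hΦ : ∀ (γ : Γ) g, Φ (γ * g) = Φ g) :
    ∑ a, ∫⁻ g in F, Φ (h a * g) ∂μ = Fintype.card P * ∫⁻ g in F, Φ g ∂μ := by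
  classical
  have hFm := hF.nullMeasurableSet
  have ind : ∀ f : G → ENNReal, ∫⁻ g in F, f g ∂μ = ∫⁻ g, F.indicator 1 g * f g ∂μ := by
    intro f
    rw [← lintegral_indicator₀ hFm]
    congr 1; ext g
    by_cases hg : g ∈ F <;> simp [hg]
  have step1 : ∀ a, ∫⁻ g in F, Φ (h a * g) ∂μ
      = ∑' γ : Γ, ∫⁻ g in F, F.indicator 1 (((γ : G) * h a)⁻¹ * g) * Φ g ∂μ := by
    intro a
    rw [ind, ← lintegral_mul_left_eq_self _ (h a)⁻¹, hF.lintegral_eq_tsum']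
    refine tsum_congr fun γ => ?_
    congr 1; ext g
    rw [mul_inv_cancel_left, _root_.mul_inv_rev, mul_assoc]
    congr 1
    exact hΦ γ⁻¹ g
  have step2 : ∀ b (γ : Γ), ∫⁻ g in F, F.indicator 1 ((k b * (γ : G))⁻¹ * g) * Φ g ∂μ
      = ∫⁻ g in F, F.indicator 1 (k b * (γ • g)) * Φ (k b * (γ • g)) ∂μ := by
    intro b γ
    rw [ind, ← lintegral_mul_left_eq_self _ (k b * (γ : G)), ind]
    congr 1; ext g
    rw [inv_mul_cancel_left]
    have : k b * (γ • g) = k b * (γ : G) * g := by rw [mul_assoc]; rfl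
    rw [this]
    ring
  calc ∑ a, ∫⁻ g in F, Φ (h a * g) ∂μ
      = ∑' x : P × Γ, ∫⁻ g in F, F.indicator 1 (((x.2 : G) * h x.1)⁻¹ * g) * Φ g ∂μ := by
        rw [ENNReal.tsum_prod', tsum_fintype]
        exact Finset.sum_congr rfl fun a _ => step1 a
    _ = ∑' x : P × Γ, ∫⁻ g in F, F.indicator 1 ((k x.1 * (x.2 : G))⁻¹ * g) * Φ g ∂μ := by
        rw [← σ.tsum_eq fun x : P × Γ =>
          ∫⁻ g in F, F.indicator 1 ((k x.1 * (x.2 : G))⁻¹ * g) * Φ g ∂μ]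
        exact tsum_congr fun x => by rw [hσ]
    _ = ∑ b : P, ∫⁻ g in F, Φ g ∂μ := by
        rw [ENNReal.tsum_prod', tsum_fintype]
        refine Finset.sum_congr rfl fun b _ => ?_
        simp_rw [step2]
        rw [← hF.lintegral_eq_tsum'' (fun g => F.indicator 1 (k b * g) * Φ (k b * g)),
          lintegral_mul_left_eq_self (fun g => F.indicator 1 g * Φ g), ind]
    _ = _ := by simp

/-- A nonnegative `φ` is bounded in mean by any eventual pointwise bound for averages of `φ`
along families whose averaging operators do not decrease integrals of invariant functions. -/
lemma setLIntegral_le_of_eventually_average_le {G : Type*} [Mul G] [MeasurableSpace G]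
    [MeasurableMul G] (μ : Measure G) {F : Set G} (hF1 : μ F = 1)
    {P : ℕ → Type*} [∀ k, Fintype (P k)] [∀ k, Nonempty (P k)] (h : ∀ k, P k → G)
    (φ : G → ENNReal) (hφm : Measurable φ)
    (hφ : ∀ T k, ∑ a, ∫⁻ g in F, min (φ (h k a * g)) T ∂μ
      = Fintype.card (P k) * ∫⁻ g in F, min (φ g) T ∂μ)
    (C : ENNReal)
    (hC : ∀ g, ∀ᶠ k in Filter.atTop,
      (Fintype.card (P k) : ENNReal)⁻¹ * ∑ a, φ (h k a * g) ≤ C) :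
    ∫⁻ g in F, φ g ∂μ ≤ C := by
  have key : ∀ T : ℕ, ∫⁻ g in F, min (φ g) T ∂μ ≤ C := by
    intro T
    set A : ℕ → G → ENNReal := fun k g =>
      (Fintype.card (P k) : ENNReal)⁻¹ * ∑ a, min (φ (h k a * g)) T with hA
    have hm : ∀ k a, Measurable fun g => min (φ (h k a * g)) (T : ENNReal) := fun k a =>
      (hφm.comp (measurable_const_mul _)).min measurable_const
    have hc0 : ∀ k, (Fintype.card (P k) : ENNReal) ≠ 0 := fun k => by
      simp [Fintype.card_ne_zero]
    have hAm : ∀ k, Measurable (A k) := fun k =>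
      (Finset.measurable_sum _ fun a _ => hm k a).const_mul _
    have hAint : ∀ k, ∫⁻ g in F, A k g ∂μ = ∫⁻ g in F, min (φ g) T ∂μ := by
      intro k
      rw [lintegral_const_mul _ (Finset.measurable_sum _ fun a _ => hm k a),
        lintegral_finsetSum _ fun a _ => hm k a, hφ, ← mul_assoc,
        ENNReal.inv_mul_cancel (hc0 k) (by simp), one_mul]
    have hAT : ∀ k g, A k g ≤ T := by
      intro k g
      calc A k g ≤ (Fintype.card (P k) : ENNReal)⁻¹ * ∑ a : P k, (T : ENNReal) := by
            simp only [hA]; gcongr; exact min_le_right _ _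
        _ = T := by
            rw [Finset.sum_const, Finset.card_univ, nsmul_eq_mul, ← mul_assoc,
              ENNReal.inv_mul_cancel (hc0 k) (by simp), one_mul]
    have hlim := limsup_lintegral_le (μ := μ.restrict F) (f := A) (fun _ => (T : ENNReal))
      (fun k => hAm k)
      (fun k => Filter.Eventually.of_forall (hAT k)) (by simp [hF1])
    simp_rw [hAint] at hlim
    rw [Filter.limsup_const] at hlim
    refine hlim.trans ?_
    calc _ ≤ ∫⁻ g in F, C ∂μ := by
          refine lintegral_mono fun g => ?_
          refine Filter.limsup_le_of_le (by isBoundedDefault) ?_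
          filter_upwards [hC g] with k hk
          refine le_trans ?_ hk
          simp only [hA]; gcongr; exact min_le_left _ _
      _ = C := by simp [hF1]
  have hsup : ∀ g, φ g = ⨆ T : ℕ, min (φ g) T := by
    intro g
    rw [← inf_iSup_eq, ENNReal.iSup_natCast, inf_top_eq]
  calc ∫⁻ g in F, φ g ∂μ = ∫⁻ g in F, ⨆ T : ℕ, min (φ g) T ∂μ := by simp_rw [← hsup]
    _ = ⨆ T : ℕ, ∫⁻ g in F, min (φ g) T ∂μ :=
        lintegral_iSup (fun T => hφm.min measurable_const)
          (fun a b hab g => by dsimp only; gcongr)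
    _ ≤ C := iSup_le key

/-- The pairing of an integer vector with a vector over `ℤ/p`. -/
def modPair {n : ℕ} (p : ℕ) (v : Fin n → ℤ) (a : Fin n → ZMod p) : ZMod p :=
  ∑ i, (v i : ZMod p) * a i

lemma exists_det_eq_and_range_vecMul {n : ℕ} (p : ℕ) [Fact p.Prime] (a : Fin n → ZMod p)
    (ha : a ≠ 0) :
    ∃ M : Matrix (Fin n) (Fin n) ℤ, M.det = p ∧
      ∀ v, (∃ w, Matrix.vecMul w M = v) ↔ modPair p v a = 0 := by
  obtain ⟨i, hi⟩ := Function.ne_iff.1 ha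
  simp only [Pi.zero_apply] at hi
  let b : Fin n → ℤ := fun j => ((a j * (a i)⁻¹).val : ℤ)
  have hb : ∀ j, (b j : ZMod p) * a i = a j := by
    intro j
    simp only [b, Int.cast_natCast, ZMod.natCast_zmod_val]
    field_simp
  let c : Fin n → ℤ := fun j => if j = i then (p : ℤ) else - b j
  have hvm : ∀ w : Fin n → ℤ, Matrix.vecMul w ((1 : Matrix (Fin n) (Fin n) ℤ).updateCol i c)
      = Function.update w i (w ⬝ᵥ c) := by
    intro w
    ext j
    rw [Matrix.vecMul, Function.update_apply]
    split_ifs with h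
    · subst h; congr 1; ext k; simp
    · rw [← Matrix.vecMul, Matrix.vecMul_eq_sum]
      simp [h, Matrix.one_apply]
  have hmod : ∀ w : Fin n → ℤ, modPair p w a
      = a i * (w i + ∑ j ∈ Finset.univ.erase i, (w j : ZMod p) * b j) := by
    intro w
    rw [modPair, ← Finset.add_sum_erase _ _ (Finset.mem_univ i), mul_add, Finset.mul_sum]
    congr 1
    · ring
    · exact Finset.sum_congr rfl fun j _ => by rw [← hb j]; ring
  have hdot : ∀ w : Fin n → ℤ, w ⬝ᵥ c = w i * p - ∑ j ∈ Finset.univ.erase i, w j * b j := by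
    intro w
    rw [dotProduct, ← Finset.add_sum_erase _ _ (Finset.mem_univ i), sub_eq_add_neg,
      ← Finset.sum_neg_distrib]
    congr 1
    · simp [c]
    · exact Finset.sum_congr rfl fun j hj => by simp [c, Finset.ne_of_mem_erase hj]
  refine ⟨(1 : Matrix (Fin n) (Fin n) ℤ).updateCol i c, ?_, fun v => ⟨?_, fun hv => ?_⟩⟩
  · rw [← Matrix.cramer_apply, Matrix.cramer_one]; simp [c]
  · rintro ⟨w, rfl⟩
    rw [hvm, hmod]
    have : ∑ j ∈ Finset.univ.erase i, ((Function.update w i (w ⬝ᵥ c) j : ℤ) : ZMod p) * b j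
        = ∑ j ∈ Finset.univ.erase i, (w j : ZMod p) * b j :=
      Finset.sum_congr rfl fun j hj => by
        rw [Function.update_of_ne (Finset.ne_of_mem_erase hj)]
    rw [this, Function.update_self, hdot]
    push_cast
    simp
  · rw [hmod] at hv
    have h0 := (mul_eq_zero.1 hv).resolve_left hi
    have h1 : ((v i + ∑ j ∈ Finset.univ.erase i, v j * b j : ℤ) : ZMod p) = 0 := by
      push_cast; exact h0
    obtain ⟨q, hq⟩ := (ZMod.intCast_zmod_eq_zero_iff_dvd _ p).1 h1
    refine ⟨Function.update v i q, ?_⟩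
    rw [hvm, hdot]
    have : ∑ j ∈ Finset.univ.erase i, Function.update v i q j * b j
        = ∑ j ∈ Finset.univ.erase i, v j * b j :=
      Finset.sum_congr rfl fun j hj => by
        rw [Function.update_of_ne (Finset.ne_of_mem_erase hj)]
    rw [this, Function.update_idem, Function.update_self]
    convert Function.update_eq_self i v using 2
    linarith

lemma modPair_smul {n : ℕ} (p : ℕ) (v : Fin n → ℤ) (c : ZMod p) (a : Fin n → ZMod p) :
    modPair p v (c • a) = c * modPair p v a := by
  simp only [modPair, Finset.mul_sum, Pi.smul_apply, smul_eq_mul]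
  exact Finset.sum_congr rfl fun i _ => by ring

lemma mk_eq_mk_of_modPair {n : ℕ} (p : ℕ) [Fact p.Prime] (a b : Fin n → ZMod p)
    (ha : a ≠ 0) (hb : b ≠ 0) (h : ∀ v : Fin n → ℤ, modPair p v a = 0 → modPair p v b = 0) :
    Projectivization.mk (ZMod p) a ha = Projectivization.mk (ZMod p) b hb := by
  obtain ⟨i, hi⟩ := Function.ne_iff.1 ha
  simp only [Pi.zero_apply] at hi
  have key : ∀ j, a i * b j = a j * b i := by
    intro j
    have hpair : ∀ c : Fin n → ZMod p, modPair p
        (fun k => (if k = j then ((a i).val : ℤ) else 0) - (if k = i then ((a j).val : ℤ) else 0)) c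
        = a i * c j - a j * c i := by
      intro c
      simp only [modPair, Int.cast_sub, Int.cast_ite, Int.cast_natCast, ZMod.natCast_zmod_val,
        Int.cast_zero, sub_mul, Finset.sum_sub_distrib, ite_mul, zero_mul, Finset.sum_ite_eq',
        Finset.mem_univ, if_true]
    have := h _ (by rw [hpair]; ring)
    rw [hpair] at this
    exact sub_eq_zero.1 this
  have hbi : b i ≠ 0 := by
    intro h0
    apply hb
    ext j
    have := key j
    rw [h0, mul_zero] at this
    exact (mul_eq_zero.1 this).resolve_left hi
  rw [Projectivization.mk_eq_mk_iff']
  refine ⟨a i * (b i)⁻¹, ?_⟩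
  ext j
  simp only [Pi.smul_apply, smul_eq_mul]
  field_simp
  linear_combination key j

lemma exists_mul_eq_of_vecMul_range {n : ℕ} {p : ℕ} (hp : p ≠ 0)
    (M N : Matrix (Fin n) (Fin n) ℤ) (hM : M.det = p) (hN : N.det = p)
    (h : ∀ i, ∃ w, Matrix.vecMul w N = M i) :
    ∃ γ : Matrix.SpecialLinearGroup (Fin n) ℤ, (γ : Matrix (Fin n) (Fin n) ℤ) * N = M := by
  choose w hw using h
  have hmul : (Matrix.of w) * N = M := by
    ext i j
    rw [← hw i]
    rfl
  have hdet : (Matrix.of w).det = 1 := by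
    have := congrArg Matrix.det hmul
    rw [Matrix.det_mul, hM, hN] at this
    exact mul_right_cancel₀ (by exact_mod_cast hp) (this.trans (one_mul _).symm)
  exact ⟨⟨_, hdet⟩, hmul⟩

open scoped LinearAlgebra.Projectivization

/-- Multiplication on the left by `SL_n(ℤ)` identifies the integer matrices of determinant `p`
with pairs of a line over `ℤ/p` and an element of `SL_n(ℤ)`. -/
lemma exists_hecke_representatives (n p : ℕ) [Fact p.Prime] :
    ∃ M : ℙ (ZMod p) (Fin n → ZMod p) → Matrix (Fin n) (Fin n) ℤ,
      (∀ x, (M x).det = p) ∧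
      (∀ x v, (∃ w, Matrix.vecMul w (M x) = v) ↔ modPair p v x.rep = 0) ∧
      ∀ N : Matrix (Fin n) (Fin n) ℤ, N.det = p →
        ∃! y : ℙ (ZMod p) (Fin n → ZMod p) × Matrix.SpecialLinearGroup (Fin n) ℤ,
          (y.2 : Matrix (Fin n) (Fin n) ℤ) * M y.1 = N := by
  have hp : p ≠ 0 := (Fact.out : p.Prime).ne_zero
  choose M hdet hM using fun x : ℙ (ZMod p) (Fin n → ZMod p) =>
    exists_det_eq_and_range_vecMul p x.rep x.rep_nonzero
  refine ⟨M, hdet, hM, fun N hN => ?_⟩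
  obtain ⟨a, ha, hNa⟩ : ∃ a ≠ 0, (N.map (Int.castRingHom (ZMod p))).mulVec a = 0 := by
    refine Matrix.exists_mulVec_eq_zero_iff.2 ?_
    have := RingHom.map_det (Int.castRingHom (ZMod p)) N
    rw [RingHom.mapMatrix_apply] at this
    rw [← this, hN]
    simp
  have hrow : ∀ i, modPair p (N i) (Projectivization.mk (ZMod p) a ha).rep = 0 := by
    intro i
    obtain ⟨c, hc⟩ := Projectivization.exists_smul_eq_mk_rep (ZMod p) a ha
    rw [← hc, Units.smul_def, modPair_smul]
    have : modPair p (N i) a = 0 := congrFun hNa i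
    rw [this, mul_zero]
  obtain ⟨γ, hγ⟩ := exists_mul_eq_of_vecMul_range hp N (M (Projectivization.mk (ZMod p) a ha)) hN
    (hdet _) fun i => (hM _ _).2 (hrow i)
  refine ⟨(Projectivization.mk (ZMod p) a ha, γ), hγ, ?_⟩
  have hsub : ∀ (x y : ℙ (ZMod p) (Fin n → ZMod p)) (γ δ : Matrix.SpecialLinearGroup (Fin n) ℤ),
      (γ : Matrix (Fin n) (Fin n) ℤ) * M x = δ * M y → x = y := by
    intro x y γ δ h
    rw [← x.mk_rep, ← y.mk_rep]
    refine mk_eq_mk_of_modPair p _ _ x.rep_nonzero y.rep_nonzero fun v hv => ?_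
    obtain ⟨w, rfl⟩ := (hM x v).2 hv
    refine (hM y _).1 ⟨Matrix.vecMul w ((γ⁻¹ * δ : Matrix.SpecialLinearGroup (Fin n) ℤ) :
      Matrix (Fin n) (Fin n) ℤ), ?_⟩
    rw [Matrix.vecMul_vecMul, Matrix.SpecialLinearGroup.coe_mul, Matrix.mul_assoc, ← h,
      ← Matrix.mul_assoc, ← Matrix.SpecialLinearGroup.coe_mul, inv_mul_cancel,
      Matrix.SpecialLinearGroup.coe_one, Matrix.one_mul]
  rintro ⟨x, δ⟩ h
  dsimp only at h
  obtain rfl := hsub x _ δ γ (h.trans hγ.symm)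
  have hreg : IsRegular (M (Projectivization.mk (ZMod p) a ha)) :=
    Matrix.isRegular_of_isLeftRegular_det (by
      rw [hdet]; exact (IsRegular.of_ne_zero (by exact_mod_cast hp)).left)
  rw [Prod.mk.injEq]
  exact ⟨rfl, Subtype.ext (hreg.right (h.trans hγ.symm))⟩

/-- The element `p^{-1/n} M` of `SL_n(ℝ)` attached to an integer matrix `M` of determinant `p`. -/
def heckeElt {n : ℕ} (hn : n ≠ 0) {p : ℕ} (hp : p ≠ 0) (M : Matrix (Fin n) (Fin n) ℤ)
    (hM : M.det = p) : SLR n :=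
  ⟨((p : ℝ) ^ (-(n : ℝ)⁻¹)) • M.map (Int.castRingHom ℝ), by
    have h := RingHom.map_det (Int.castRingHom ℝ) M
    rw [RingHom.mapMatrix_apply] at h
    have hp' : (0 : ℝ) < p := by exact_mod_cast Nat.pos_of_ne_zero hp
    rw [Matrix.det_smul, ← h, hM, Fintype.card_fin, ← Real.rpow_mul_natCast hp'.le, neg_mul,
      inv_mul_cancel₀ (by exact_mod_cast hn), Real.rpow_neg_one]
    simp [hp'.ne']⟩

lemma vecMul_intVec_map {n : ℕ} (w : Fin n → ℤ) (M : Matrix (Fin n) (Fin n) ℤ) :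
    Matrix.vecMul (intVec w) (M.map (Int.castRingHom ℝ)) = intVec (Matrix.vecMul w M) := by
  ext j
  simp [Matrix.vecMul, dotProduct, intVec]

/-- The sum of `f` over the nonzero points of the lattice `ℤⁿg`. -/
def siegel {n : ℕ} (f : (Fin n → ℝ) → ENNReal) (g : SLR n) : ENNReal :=
  ∑' v : Fin n → ℤ, ({0}ᶜ : Set (Fin n → ℝ)).indicator f
    (Matrix.vecMul (intVec v) (g : Matrix (Fin n) (Fin n) ℝ))

lemma siegel_mul_left {n : ℕ} (f : (Fin n → ℝ) → ENNReal) (γ : Gam n) (g : SLR n) :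
    siegel f (γ * g) = siegel f g := by
  obtain ⟨_, γ, rfl⟩ := γ
  let e : (Fin n → ℤ) ≃ (Fin n → ℤ) :=
    { toFun := fun v => Matrix.vecMul v (γ : Matrix (Fin n) (Fin n) ℤ)
      invFun := fun v => Matrix.vecMul v ((γ⁻¹ : Matrix.SpecialLinearGroup (Fin n) ℤ) :
        Matrix (Fin n) (Fin n) ℤ)
      left_inv := fun v => by
        simp only [Matrix.vecMul_vecMul, ← Matrix.SpecialLinearGroup.coe_mul, mul_inv_cancel,
          Matrix.SpecialLinearGroup.coe_one, Matrix.vecMul_one]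
      right_inv := fun v => by
        simp only [Matrix.vecMul_vecMul, ← Matrix.SpecialLinearGroup.coe_mul, inv_mul_cancel,
          Matrix.SpecialLinearGroup.coe_one, Matrix.vecMul_one] }
  rw [siegel, siegel, ← e.tsum_eq fun v => ({0}ᶜ : Set (Fin n → ℝ)).indicator f
    (Matrix.vecMul (intVec v) (g : Matrix (Fin n) (Fin n) ℝ))]
  refine tsum_congr fun v => ?_
  congr 1
  rw [Matrix.SpecialLinearGroup.coe_mul, ← Matrix.vecMul_vecMul]
  congr 1
  exact vecMul_intVec_map v γ

lemma measurable_siegel {n : ℕ} {f : (Fin n → ℝ) → ENNReal} (hf : Measurable f) :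
    Measurable (siegel f) := by
  refine Measurable.tsum fun v => ?_
  refine (hf.indicator (measurableSet_singleton 0).compl).comp ?_
  have : Continuous fun g : SLR n => Matrix.vecMul (intVec v) (g : Matrix (Fin n) (Fin n) ℝ) :=
    continuous_const.matrix_vecMul (continuous_coe_SLR n)
  exact this.measurable

lemma exists_hecke_average {n : ℕ} (hn : n ≠ 0) (p : ℕ) [Fact p.Prime] :
    ∃ h : ℙ (ZMod p) (Fin n → ZMod p) → SLR n,
      (∀ (μ : Measure (SLR n)) [μ.IsHaarMeasure] (F : Set (SLR n)),
        IsFundamentalDomain (Gam n) F μ → ∀ Φ : SLR n → ENNReal,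
        (∀ (γ : Gam n) g, Φ (γ * g) = Φ g) →
        ∑' x, ∫⁻ g in F, Φ (h x * g) ∂μ
          = Nat.card (ℙ (ZMod p) (Fin n → ZMod p)) * ∫⁻ g in F, Φ g ∂μ) ∧
      ∀ (f : (Fin n → ℝ) → ENNReal) x g, siegel f (h x * g) =
        ∑' w : Fin n → ℤ, if modPair p w x.rep = 0 then ({0}ᶜ : Set (Fin n → ℝ)).indicator f
          (((p : ℝ) ^ (-(n : ℝ)⁻¹)) • Matrix.vecMul (intVec w) (g : Matrix (Fin n) (Fin n) ℝ))
          else 0 := by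
  classical
  have hp : p ≠ 0 := (Fact.out : p.Prime).ne_zero
  obtain ⟨M, hdet, hM, huniq⟩ := exists_hecke_representatives n p
  refine ⟨fun x => heckeElt hn hp (M x) (hdet x), ?_, ?_⟩
  · intro μ _ F hF Φ hΦ
    have : Fintype (ℙ (ZMod p) (Fin n → ZMod p)) := Fintype.ofFinite _
    let e : ℙ (ZMod p) (Fin n → ZMod p) × Matrix.SpecialLinearGroup (Fin n) ℤ ≃
        {N : Matrix (Fin n) (Fin n) ℤ // N.det = p} :=
      Equiv.ofBijective (fun y => ⟨(y.2 : Matrix (Fin n) (Fin n) ℤ) * M y.1, by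
        rw [Matrix.det_mul, hdet, y.2.2, one_mul]⟩) (by
        rw [Function.bijective_iff_existsUnique]
        rintro ⟨N, hN⟩
        simpa only [Subtype.mk.injEq] using huniq N hN)
    have he : ∀ y, ((e y : {N : Matrix (Fin n) (Fin n) ℤ // N.det = p}) :
        Matrix (Fin n) (Fin n) ℤ) = (y.2 : Matrix (Fin n) (Fin n) ℤ) * M y.1 := fun y => rfl
    let τ : {N : Matrix (Fin n) (Fin n) ℤ // N.det = p} ≃
        {N : Matrix (Fin n) (Fin n) ℤ // N.det = p} :=
      { toFun := fun N => ⟨N.1.transpose, by rw [Matrix.det_transpose, N.2]⟩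
        invFun := fun N => ⟨N.1.transpose, by rw [Matrix.det_transpose, N.2]⟩
        left_inv := fun N => by simp
        right_inv := fun N => by simp }
    let tr : Matrix.SpecialLinearGroup (Fin n) ℤ ≃ Matrix.SpecialLinearGroup (Fin n) ℤ :=
      { toFun := fun N => ⟨N.1.transpose, by rw [Matrix.det_transpose, N.2]⟩
        invFun := fun N => ⟨N.1.transpose, by rw [Matrix.det_transpose, N.2]⟩
        left_inv := fun N => by ext; simp
        right_inv := fun N => by ext; simp }
    have hinj : Function.Injective
        (Matrix.SpecialLinearGroup.map (n := Fin n) (Int.castRingHom ℝ)) := by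
      intro a b hab
      ext i j
      have := congrArg (fun g : SLR n => (g : Matrix (Fin n) (Fin n) ℝ) i j) hab
      simpa using this
    let ι : Matrix.SpecialLinearGroup (Fin n) ℤ ≃ Gam n := (MonoidHom.ofInjective hinj).toEquiv
    have hι : ∀ γ, (((ι γ : Gam n) : SLR n) : Matrix (Fin n) (Fin n) ℝ)
        = (γ : Matrix (Fin n) (Fin n) ℤ).map (Int.castRingHom ℝ) := fun γ => rfl
    let σ0 := (e.trans τ).trans e.symm |>.trans ((Equiv.refl _).prodCongr tr)
    have hσ0 : ∀ y, (y.2 : Matrix (Fin n) (Fin n) ℤ) * M y.1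
        = (M (σ0 y).1).transpose * ((σ0 y).2 : Matrix (Fin n) (Fin n) ℤ) := by
      intro y
      have h1 : τ (e y) = e (e.symm (τ (e y))) := (e.apply_symm_apply _).symm
      have h2 := congrArg (fun N => N.1.transpose) h1
      simp only [he, Matrix.transpose_mul] at h2
      exact h2
    have hiι : ∀ γ : Gam n, (((γ : Gam n) : SLR n) : Matrix (Fin n) (Fin n) ℝ)
        = ((ι.symm γ : Matrix.SpecialLinearGroup (Fin n) ℤ) :
            Matrix (Fin n) (Fin n) ℤ).map (Int.castRingHom ℝ) := fun γ => by
      rw [← hι, Equiv.apply_symm_apply]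
    have := sum_setLIntegral_mul_left (Gam n) μ hF
      (fun x => heckeElt hn hp (M x) (hdet x))
      (fun x => heckeElt hn hp (M x).transpose (by rw [Matrix.det_transpose, hdet x]))
      (((Equiv.refl _).prodCongr ι.symm).trans (σ0.trans ((Equiv.refl _).prodCongr ι)))
      (by
        rintro ⟨x, γ⟩
        apply Subtype.ext
        have h := congrArg (fun N : Matrix (Fin n) (Fin n) ℤ => N.map (Int.castRingHom ℝ))
          (hσ0 (x, ι.symm γ))
        simp only [Matrix.map_mul] at h
        change ((γ : Gam n) : SLR n).1 * (((p : ℝ) ^ (-(n : ℝ)⁻¹)) • _)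
          = (((p : ℝ) ^ (-(n : ℝ)⁻¹)) • _) * ((ι (σ0 (x, ι.symm γ)).2 : Gam n) : SLR n).1
        rw [hι, hiι, Matrix.mul_smul, Matrix.smul_mul]
        exact congrArg _ h) Φ hΦ
    rw [tsum_fintype, this, Nat.card_eq_fintype_card]
  · intro f x g
    have hinj : Function.Injective fun w : Fin n → ℤ => Matrix.vecMul w (M x) :=
      fun w w' h => sub_eq_zero.1 <| Matrix.eq_zero_of_vecMul_eq_zero
        (by rw [hdet]; exact_mod_cast hp) (by rw [Matrix.sub_vecMul]; exact sub_eq_zero.2 h)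
    have hv : ∀ v : Fin n → ℤ, Matrix.vecMul (intVec v)
        ((heckeElt hn hp (M x) (hdet x) * g : SLR n) : Matrix (Fin n) (Fin n) ℝ)
        = ((p : ℝ) ^ (-(n : ℝ)⁻¹)) • Matrix.vecMul (intVec (Matrix.vecMul v (M x)))
          (g : Matrix (Fin n) (Fin n) ℝ) := by
      intro v
      rw [Matrix.SpecialLinearGroup.coe_mul, ← Matrix.vecMul_vecMul]
      simp only [heckeElt]
      rw [Matrix.vecMul_smul, vecMul_intVec_map, Matrix.smul_vecMul]
    simp_rw [siegel, hv]
    rw [← hinj.tsum_eq (f := fun w => if modPair p w x.rep = 0 then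
      ({0}ᶜ : Set (Fin n → ℝ)).indicator f
        (((p : ℝ) ^ (-(n : ℝ)⁻¹)) • Matrix.vecMul (intVec w) (g : Matrix (Fin n) (Fin n) ℝ))
        else 0)]
    · refine tsum_congr fun v => ?_
      rw [if_pos ((hM x _).1 ⟨v, rfl⟩)]
    · intro w hw
      rw [Function.mem_support] at hw
      exact (hM x w).2 (by_contra fun h => hw (if_neg h))

lemma card_ker_mul_card {A B : Type*} [AddCommGroup A] [AddCommGroup B] [Fintype A] [Fintype B]
    [DecidableEq B] (φ : A →+ B) (hφ : Function.Surjective φ) :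
    (Finset.univ.filter fun a => φ a = 0).card * Fintype.card B = Fintype.card A := by
  have h := AddSubgroup.card_mul_index φ.ker
  rw [AddSubgroup.index_ker, AddMonoidHom.range_eq_top.2 hφ] at h
  rw [← Nat.card_eq_fintype_card (α := A), ← h, AddSubgroup.card_top, Nat.card_eq_fintype_card,
    Nat.card_eq_fintype_card, ← Fintype.card_subtype]
  congr 1
  exact Fintype.card_congr (Equiv.refl _)

/-- `modPair` as an additive homomorphism in the second variable. -/
def modPairHom {n : ℕ} (p : ℕ) (v : Fin n → ℤ) : (Fin n → ZMod p) →+ ZMod p where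
  toFun := modPair p v
  map_zero' := by simp [modPair]
  map_add' a b := by simp [modPair, mul_add, Finset.sum_add_distrib]

lemma modPairHom_apply {n : ℕ} (p : ℕ) (v : Fin n → ℤ) (a : Fin n → ZMod p) :
    modPairHom p v a = modPair p v a := rfl

lemma modPair_single {n : ℕ} (p : ℕ) (v : Fin n → ℤ) (i : Fin n) (c : ZMod p) :
    modPair p v (Pi.single i c) = v i * c := by
  simp [modPair, Pi.single_apply]

lemma card_modPair_eq_zero {n : ℕ} (p : ℕ) [Fact p.Prime] (v : Fin n → ℤ)
    (hv : ∃ i, (v i : ZMod p) ≠ 0) :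
    (Finset.univ.filter fun a : Fin n → ZMod p => modPair p v a = 0).card * p = p ^ n := by
  obtain ⟨i, hi⟩ := hv
  have : (Finset.univ.filter fun a : Fin n → ZMod p => modPair p v a = 0).card
      * Fintype.card (ZMod p) = Fintype.card (Fin n → ZMod p) :=
    card_ker_mul_card (modPairHom p v) (fun c => ⟨Pi.single i ((v i : ZMod p)⁻¹ * c), by
    change modPair p v _ = c
    rw [modPair_single, mul_inv_cancel_left₀ hi]⟩)
  simpa using this

lemma card_modPair_eq_zero_and {n : ℕ} (p : ℕ) [Fact p.Prime] (v w : Fin n → ℤ) (i j : Fin n)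
    (h : (v i * w j - v j * w i : ZMod p) ≠ 0) :
    (Finset.univ.filter fun a : Fin n → ZMod p => modPair p v a = 0 ∧ modPair p w a = 0).card
      * p ^ 2 = p ^ n := by
  have := card_ker_mul_card ((modPairHom p v).prod (modPairHom p w)) (by
    rintro ⟨c, d⟩
    refine ⟨Pi.single i ((v i * w j - v j * w i : ZMod p)⁻¹ * (w j * c - v j * d))
      + Pi.single j ((v i * w j - v j * w i : ZMod p)⁻¹ * (v i * d - w i * c)), ?_⟩
    rw [map_add]
    simp only [AddMonoidHom.prod_apply]
    change (modPair p v _, modPair p w _) + (modPair p v _, modPair p w _) = (c, d)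
    simp only [modPair_single, Prod.mk_add_mk, Prod.mk.injEq]
    have hinv := mul_inv_cancel₀ h
    constructor
    · linear_combination c * hinv
    · linear_combination d * hinv)
  simpa [modPairHom_apply, sq] using this

/-- Linear dependence of two integer vectors, expressed through `2 × 2` minors. -/
def Proportional {n : ℕ} (v w : Fin n → ℤ) : Prop := ∀ i j, v i * w j = v j * w i

open scoped Classical in
/-- The mean square of the sum of `F` over a random hyperplane modulo `p`. -/
lemma sum_sq_modPair_le {n : ℕ} (p : ℕ) [Fact p.Prime] (B : Finset (Fin n → ℤ))
    (F : (Fin n → ℤ) → ℝ) (hF : ∀ v, 0 ≤ F v) (I : ℝ)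
    (h1 : ∀ v ∈ B, ∃ i, (v i : ZMod p) ≠ 0)
    (h2 : ∀ v ∈ B, ∀ w ∈ B, ¬ Proportional v w →
      ∃ i j, (v i * w j - v j * w i : ZMod p) ≠ 0) :
    ((p : ℝ) ^ n)⁻¹ * ∑ a : Fin n → ZMod p, ((∑ v ∈ B, if modPair p v a = 0 then F v else 0) - I) ^ 2
      ≤ ((∑ v ∈ B, F v) / p - I) ^ 2
        + (p : ℝ)⁻¹ * ∑ v ∈ B, ∑ w ∈ B, if Proportional v w then F v * F w else 0 := by
  have hp : (0 : ℝ) < p := by exact_mod_cast (Fact.out : p.Prime).pos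
  have e1 : ((p : ℝ) ^ n)⁻¹ * ∑ a : Fin n → ZMod p, (∑ v ∈ B, if modPair p v a = 0 then F v else 0)
      = (∑ v ∈ B, F v) / p := by
    rw [Finset.sum_comm, Finset.mul_sum, Finset.sum_div]
    refine Finset.sum_congr rfl fun v hv => ?_
    have := card_modPair_eq_zero p v (h1 v hv)
    have h' : ((Finset.univ.filter fun a : Fin n → ZMod p => modPair p v a = 0).card : ℝ) * p
        = p ^ n := by exact_mod_cast this
    rw [← Finset.sum_filter, Finset.sum_const, nsmul_eq_mul, ← h']
    have : ((Finset.univ.filter fun a : Fin n → ZMod p => modPair p v a = 0).card : ℝ) ≠ 0 := by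
      intro h0
      rw [h0, zero_mul] at h'
      exact absurd h'.symm (by positivity)
    field_simp
  have e2 : ((p : ℝ) ^ n)⁻¹ *
      ∑ a : Fin n → ZMod p, (∑ v ∈ B, if modPair p v a = 0 then F v else 0) ^ 2
      ≤ ((∑ v ∈ B, F v) / p) ^ 2
        + (p : ℝ)⁻¹ * ∑ v ∈ B, ∑ w ∈ B, if Proportional v w then F v * F w else 0 := by
    have : ∀ v ∈ B, ∀ w ∈ B, ((p : ℝ) ^ n)⁻¹ * ∑ a : Fin n → ZMod p,
        ((if modPair p v a = 0 then F v else 0) * if modPair p w a = 0 then F w else 0)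
        ≤ F v * F w / p ^ 2 + (p : ℝ)⁻¹ * if Proportional v w then F v * F w else 0 := by
      intro v hv w hw
      have hvw := mul_nonneg (hF v) (hF w)
      by_cases hP : Proportional v w
      · rw [if_pos hP]
        have h := card_modPair_eq_zero p v (h1 v hv)
        have h' : ((Finset.univ.filter fun a : Fin n → ZMod p => modPair p v a = 0).card : ℝ) * p
            = p ^ n := by exact_mod_cast h
        have hle : ∑ a : Fin n → ZMod p,
            ((if modPair p v a = 0 then F v else 0) * if modPair p w a = 0 then F w else 0)
            ≤ (Finset.univ.filter fun a : Fin n → ZMod p => modPair p v a = 0).card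
              * (F v * F w) := by
          rw [← nsmul_eq_mul, ← Finset.sum_const, Finset.sum_filter]
          refine Finset.sum_le_sum fun a _ => ?_
          split_ifs <;> simp [hvw]
        calc _ ≤ ((p : ℝ) ^ n)⁻¹ * ((Finset.univ.filter
              fun a : Fin n → ZMod p => modPair p v a = 0).card * (F v * F w)) := by gcongr
          _ = (p : ℝ)⁻¹ * (F v * F w) := by
            have : ((Finset.univ.filter fun a : Fin n → ZMod p => modPair p v a = 0).card : ℝ)
                = p ^ n / p := by rw [← h']; field_simp
            rw [this]
            field_simp
          _ ≤ _ := le_add_of_nonneg_left (by positivity)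
      · obtain ⟨i, j, hij⟩ := h2 v hv w hw hP
        rw [if_neg hP, mul_zero, add_zero]
        have h := card_modPair_eq_zero_and p v w i j hij
        have h' : ((Finset.univ.filter fun a : Fin n → ZMod p =>
            modPair p v a = 0 ∧ modPair p w a = 0).card : ℝ) = p ^ n / p ^ 2 := by
          rw [eq_div_iff (by positivity)]; exact_mod_cast h
        have heq : ∑ a : Fin n → ZMod p,
            ((if modPair p v a = 0 then F v else 0) * if modPair p w a = 0 then F w else 0)
            = (Finset.univ.filter fun a : Fin n → ZMod p =>
                modPair p v a = 0 ∧ modPair p w a = 0).card * (F v * F w) := by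
          rw [← nsmul_eq_mul, ← Finset.sum_const, Finset.sum_filter]
          refine Finset.sum_congr rfl fun a _ => ?_
          by_cases ha : modPair p v a = 0 <;> by_cases hb : modPair p w a = 0 <;> simp [ha, hb]
        rw [heq, h']
        apply le_of_eq
        field_simp
    calc ((p : ℝ) ^ n)⁻¹ *
        ∑ a : Fin n → ZMod p, (∑ v ∈ B, if modPair p v a = 0 then F v else 0) ^ 2
        = ∑ v ∈ B, ∑ w ∈ B, ((p : ℝ) ^ n)⁻¹ * ∑ a : Fin n → ZMod p,
        ((if modPair p v a = 0 then F v else 0) * if modPair p w a = 0 then F w else 0) := by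
          simp_rw [← Finset.mul_sum]
          congr 1
          simp_rw [sq, Finset.sum_mul_sum]
          rw [Finset.sum_comm]
          refine Finset.sum_congr rfl fun v _ => ?_
          rw [Finset.sum_comm]
      _ ≤ ∑ v ∈ B, ∑ w ∈ B,
          (F v * F w / p ^ 2 + (p : ℝ)⁻¹ * if Proportional v w then F v * F w else 0) :=
          Finset.sum_le_sum fun v hv => Finset.sum_le_sum fun w hw => this v hv w hw
      _ = _ := by
          simp_rw [Finset.sum_add_distrib, ← Finset.mul_sum, ← Finset.sum_div]
          rw [div_pow, sq (∑ v ∈ B, F v), Finset.sum_mul_sum]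
  have hsum : ∑ a : Fin n → ZMod p, ((∑ v ∈ B, if modPair p v a = 0 then F v else 0) - I) ^ 2
      = ∑ a : Fin n → ZMod p, (∑ v ∈ B, if modPair p v a = 0 then F v else 0) ^ 2
        - 2 * I * ∑ a : Fin n → ZMod p, (∑ v ∈ B, if modPair p v a = 0 then F v else 0)
        + p ^ n * I ^ 2 := by
    have hc : (Fintype.card (Fin n → ZMod p) : ℝ) = p ^ n := by simp
    rw [← hc, ← nsmul_eq_mul, ← Finset.card_univ, ← Finset.sum_const, Finset.mul_sum,
      ← Finset.sum_sub_distrib, ← Finset.sum_add_distrib]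
    exact Finset.sum_congr rfl fun a _ => by ring
  rw [hsum, mul_add, mul_sub, mul_left_comm, e1, ← mul_assoc ((p : ℝ) ^ n)⁻¹ ((p : ℝ) ^ n),
    inv_mul_cancel₀ (by positivity)]
  nlinarith [e2]

/-- An average over lines of a function of the line is controlled by the average over vectors. -/
lemma average_projectivization_le {n : ℕ} (hn : n ≠ 0) (p : ℕ) [Fact p.Prime]
    [Fintype (ℙ (ZMod p) (Fin n → ZMod p))]
    (ψ : (Fin n → ZMod p) → ℝ) (h0 : ∀ a, 0 ≤ ψ a)
    (hψ : ∀ (c : (ZMod p)ˣ) a, ψ (c • a) = ψ a) :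
    (Fintype.card (ℙ (ZMod p) (Fin n → ZMod p)) : ℝ)⁻¹
        * ∑ x : ℙ (ZMod p) (Fin n → ZMod p), ψ x.rep
      ≤ 2 * (((p : ℝ) ^ n)⁻¹ * ∑ a, ψ a) := by
  classical
  have hp := (Fact.out : p.Prime)
  have hinj : Function.Injective
      fun y : ℙ (ZMod p) (Fin n → ZMod p) × (ZMod p)ˣ => y.2 • y.1.rep := by
    rintro ⟨x, u⟩ ⟨y, w⟩ h
    dsimp only at h
    have hxy : x = y := by
      rw [← x.mk_rep, ← y.mk_rep, Projectivization.mk_eq_mk_iff]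
      exact ⟨u⁻¹ * w, by rw [mul_smul, ← h, inv_smul_smul]⟩
    subst hxy
    rw [Prod.mk.injEq]
    refine ⟨rfl, Units.ext ?_⟩
    exact smul_left_injective (ZMod p) x.rep_nonzero (by simpa [Units.smul_def] using h)
  have h1 : ((p : ℝ) - 1) * ∑ x : ℙ (ZMod p) (Fin n → ZMod p), ψ x.rep ≤ ∑ a, ψ a := by
    have e : ((p : ℝ) - 1) * ∑ x : ℙ (ZMod p) (Fin n → ZMod p), ψ x.rep
        = ∑ y : ℙ (ZMod p) (Fin n → ZMod p) × (ZMod p)ˣ, ψ (y.2 • y.1.rep) := by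
      rw [Fintype.sum_prod_type]
      simp only [hψ, Finset.sum_const, Finset.card_univ, ZMod.card_units_eq_totient,
        Nat.totient_prime hp, nsmul_eq_mul]
      rw [← Finset.mul_sum, Nat.cast_sub hp.one_le, Nat.cast_one]
    rw [e, ← Finset.sum_image (f := ψ) (g := fun y : ℙ (ZMod p) (Fin n → ZMod p) × (ZMod p)ˣ =>
      y.2 • y.1.rep) hinj.injOn]
    exact Finset.sum_le_univ_sum_of_nonneg h0
  have h2 : (p : ℝ) ^ n = Fintype.card (ℙ (ZMod p) (Fin n → ZMod p)) * ((p : ℝ) - 1) + 1 := by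
    have := Projectivization.card' (ZMod p) (Fin n → ZMod p)
    rw [Nat.card_zmod, Nat.card_eq_fintype_card, Nat.card_eq_fintype_card] at this
    have h3 : Fintype.card (Fin n → ZMod p) = p ^ n := by simp
    rw [h3] at this
    have h4 : ((p - 1 : ℕ) : ℝ) = p - 1 := by rw [Nat.cast_sub hp.one_le, Nat.cast_one]
    rw [← h4]
    exact_mod_cast this
  have h5 : (2 : ℝ) ≤ p ^ n :=
    calc (2 : ℝ) ≤ p := by exact_mod_cast hp.two_le
      _ ≤ p ^ n := le_self_pow₀ (by exact_mod_cast hp.one_le) hn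
  have hp1 : (0 : ℝ) < (p : ℝ) - 1 := by
    have : (2 : ℝ) ≤ p := by exact_mod_cast hp.two_le
    linarith
  have hN : (0 : ℝ) < Fintype.card (ℙ (ZMod p) (Fin n → ZMod p)) := by
    by_contra h
    nlinarith
  have hs : 0 ≤ ∑ a, ψ a := Finset.sum_nonneg fun a _ => h0 a
  rw [inv_mul_le_iff₀ hN, ← mul_le_mul_iff_right₀ hp1]
  refine h1.trans ?_
  have h6 : 1 ≤ 2 * (Fintype.card (ℙ (ZMod p) (Fin n → ZMod p)) * ((p : ℝ) - 1)) * ((p : ℝ) ^ n)⁻¹ := by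
    rw [← div_eq_mul_inv, le_div_iff₀ (by linarith)]
    linarith
  nlinarith [mul_le_mul_of_nonneg_right h6 hs]

lemma card_proportional_le {n : ℕ} {v : Fin n → ℤ} (hv : v ≠ 0) (S : Finset (Fin n → ℤ))
    (hS : ∀ w ∈ S, Proportional v w) (hle : ∀ w ∈ S, ∑ i, |w i| ≤ ∑ i, |v i|) :
    S.card ≤ 3 * (Finset.univ.gcd v).natAbs := by
  classical
  obtain ⟨k, hk⟩ := Function.ne_iff.1 hv
  obtain ⟨u, hu, hu1⟩ := Finset.extract_gcd v (⟨k, Finset.mem_univ k⟩ : Finset.univ.Nonempty)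
  set c := Finset.univ.gcd v with hc
  have hc0 : c ≠ 0 := by
    intro h
    apply hk
    rw [hu k (Finset.mem_univ k), h, zero_mul, Pi.zero_apply]
  obtain ⟨b, hb⟩ := Finset.gcd_eq_sum_mul Finset.univ u
  rw [hu1] at hb
  have hsub : S ⊆ (Finset.Icc (-|c|) |c|).image fun l => l • u := by
    intro w hw
    have hwl : w = (∑ i, b i * w i) • u := by
      ext j
      have : w j = ∑ i, u i * b i * w j := by rw [← Finset.sum_mul, ← hb, one_mul]
      rw [Pi.smul_apply, smul_eq_mul, Finset.sum_mul, this]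
      refine Finset.sum_congr rfl fun i _ => ?_
      have h := hS w hw i j
      rw [hu i (Finset.mem_univ i), hu j (Finset.mem_univ j), mul_assoc, mul_assoc] at h
      linear_combination b i * mul_left_cancel₀ hc0 h
    refine Finset.mem_image.2 ⟨∑ i, b i * w i, ?_, hwl.symm⟩
    rw [Finset.mem_Icc, ← abs_le]
    have h := hle w hw
    rw [hwl] at h
    have hv' : ∀ i, |v i| = |c| * |u i| := fun i => by rw [hu i (Finset.mem_univ i), abs_mul]
    simp only [Pi.smul_apply, smul_eq_mul, abs_mul, hv', ← Finset.mul_sum] at h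
    refine le_of_mul_le_mul_right h ?_
    have huk : u k ≠ 0 := by
      intro h0
      exact hk (by rw [hu k (Finset.mem_univ k), h0, mul_zero, Pi.zero_apply])
    exact (abs_pos.2 huk).trans_le
      (Finset.single_le_sum (f := fun i => |u i|) (fun i _ => abs_nonneg _) (Finset.mem_univ k))
  have h1 := (Finset.card_le_card hsub).trans Finset.card_image_le
  rw [Int.card_Icc, Int.abs_eq_natAbs] at h1
  omega

open scoped Classical in
lemma sum_proportional_le {n : ℕ} (B : Finset (Fin n → ℤ)) (hB : ∀ v ∈ B, v ≠ 0)
    (F : (Fin n → ℤ) → ℝ) (hF : ∀ v, 0 ≤ F v) (hF1 : ∀ v, F v ≤ 1) :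
    ∑ v ∈ B, ∑ w ∈ B, (if Proportional v w then F v * F w else 0)
      ≤ 6 * ∑ v ∈ B, (Finset.univ.gcd v).natAbs * F v := by
  have hsymm : ∀ v w : Fin n → ℤ, Proportional v w → Proportional w v := fun v w h i j => by
    rw [mul_comm, h j i, mul_comm]
  have hS : ∀ v ∈ B, ∑ w ∈ B, (if Proportional v w ∧ ∑ i, |w i| ≤ ∑ i, |v i| then F v else 0)
      ≤ 3 * ((Finset.univ.gcd v).natAbs * F v) := by
    intro v hv
    rw [← Finset.sum_filter, Finset.sum_const, nsmul_eq_mul, ← mul_assoc]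
    refine mul_le_mul_of_nonneg_right ?_ (hF v)
    exact_mod_cast card_proportional_le (hB v hv)
      (B.filter fun w => Proportional v w ∧ ∑ i, |w i| ≤ ∑ i, |v i|)
      (fun w hw => (Finset.mem_filter.1 hw).2.1) (fun w hw => (Finset.mem_filter.1 hw).2.2)
  calc ∑ v ∈ B, ∑ w ∈ B, (if Proportional v w then F v * F w else 0)
      ≤ ∑ v ∈ B, ∑ w ∈ B, ((if Proportional v w ∧ ∑ i, |w i| ≤ ∑ i, |v i| then F v else 0)
          + (if Proportional w v ∧ ∑ i, |v i| ≤ ∑ i, |w i| then F w else 0)) := by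
        refine Finset.sum_le_sum fun v _ => Finset.sum_le_sum fun w _ => ?_
        by_cases h : Proportional v w
        · have h' := hsymm v w h
          have a1 := mul_le_of_le_one_right (hF v) (hF1 w)
          have a2 := mul_le_of_le_one_left (hF w) (hF1 v)
          simp only [h, h', true_and, if_true]
          rcases le_total (∑ i, |w i|) (∑ i, |v i|) with hl | hl
          · rw [if_pos hl]
            have : 0 ≤ (if ∑ i, |v i| ≤ ∑ i, |w i| then F w else 0) := by
              split_ifs <;> simp [hF w]
            linarith
          · rw [if_pos hl]
            have : 0 ≤ (if ∑ i, |w i| ≤ ∑ i, |v i| then F v else 0) := by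
              split_ifs <;> simp [hF v]
            linarith
        · have h' : ¬ Proportional w v := fun h' => h (hsymm w v h')
          simp [h, h']
    _ = ∑ v ∈ B, ∑ w ∈ B, (if Proportional v w ∧ ∑ i, |w i| ≤ ∑ i, |v i| then F v else 0)
        + ∑ v ∈ B, ∑ w ∈ B, (if Proportional v w ∧ ∑ i, |w i| ≤ ∑ i, |v i| then F v else 0) := by
        simp_rw [Finset.sum_add_distrib]
        congr 1
        exact Finset.sum_comm
    _ ≤ ∑ v ∈ B, 3 * ((Finset.univ.gcd v).natAbs * F v)
        + ∑ v ∈ B, 3 * ((Finset.univ.gcd v).natAbs * F v) :=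
        add_le_add (Finset.sum_le_sum hS) (Finset.sum_le_sum hS)
    _ = _ := by rw [← Finset.mul_sum]; ring

lemma tsum_gcd_mul_le {n : ℕ} (F : (Fin n → ℤ) → ENNReal) :
    ∑' v, ((Finset.univ.gcd v).natAbs : ENNReal) * F v
      ≤ ∑' d : ℕ, (d : ENNReal) * ∑' u : Fin n → ℤ, F (d • u) := by
  have h : ∀ v : Fin n → ℤ, ∃ u : Fin n → ℤ, v = (Finset.univ.gcd v).natAbs • u := by
    intro v
    choose u hu using fun i : Fin n => (Int.natAbs_dvd.2 (Finset.gcd_dvd (f := v) (Finset.mem_univ i)))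
    refine ⟨u, funext fun i => ?_⟩
    rw [Pi.smul_apply, nsmul_eq_mul]
    exact hu i
  choose u hu using h
  have hinj : Function.Injective fun v : Fin n → ℤ => ((Finset.univ.gcd v).natAbs, u v) := by
    intro v w hvw
    rw [Prod.mk.injEq] at hvw
    rw [hu v, hu w, hvw.1, hvw.2]
  calc ∑' v, ((Finset.univ.gcd v).natAbs : ENNReal) * F v
      = ∑' v, (fun y : ℕ × (Fin n → ℤ) => (y.1 : ENNReal) * F (y.1 • y.2))
          ((Finset.univ.gcd v).natAbs, u v) :=
        tsum_congr fun v => by dsimp only; rw [← hu v]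
    _ ≤ ∑' y : ℕ × (Fin n → ℤ), (y.1 : ENNReal) * F (y.1 • y.2) :=
        ENNReal.tsum_comp_le_tsum_of_injective hinj _
    _ = _ := by rw [ENNReal.tsum_prod']; simp_rw [ENNReal.tsum_mul_left]

open Filter Topology

/-- The coordinatewise integer part of a vector. -/
def floorVec {n : ℕ} (x : Fin n → ℝ) : Fin n → ℤ := fun i => ⌊x i⌋

lemma measurable_floorVec {n : ℕ} : Measurable (floorVec (n := n)) :=
  measurable_pi_lambda _ fun i => Int.measurable_floor.comp (measurable_pi_apply i)

lemma map_floorVec_volume {n : ℕ} :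
    (volume : Measure (Fin n → ℝ)).map floorVec = Measure.count := by
  refine Measure.ext_of_singleton fun u => ?_
  rw [Measure.map_apply measurable_floorVec (measurableSet_singleton u), Measure.count_singleton]
  have : floorVec ⁻¹' {u} = Set.univ.pi fun i => Set.Ico (u i : ℝ) (u i + 1) := by
    ext x
    simp only [Set.mem_preimage, Set.mem_singleton_iff, Set.mem_univ_pi, ← Int.preimage_floor_singleton]
    exact funext_iff
  rw [this, volume_pi_pi]
  simp

lemma lintegral_floorVec {n : ℕ} {t : ℝ} (ht : 0 < t) (G : (Fin n → ℤ) → ENNReal) :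
    ∫⁻ x, G (floorVec (t⁻¹ • x)) = ENNReal.ofReal t ^ n * ∑' u, G u := by
  have hG : Measurable G := measurable_of_countable G
  have h := Measure.map_addHaar_smul (volume : Measure (Fin n → ℝ)) (inv_ne_zero ht.ne')
  have h1 : ∫⁻ x, G (floorVec (t⁻¹ • x))
      = ∫⁻ y, G (floorVec y) ∂((volume : Measure (Fin n → ℝ)).map (t⁻¹ • ·)) :=
    (lintegral_map (hG.comp measurable_floorVec) (measurable_const_smul _)).symm
  rw [h1, h, lintegral_smul_measure, ← lintegral_map hG measurable_floorVec, map_floorVec_volume,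
    lintegral_count, smul_eq_mul, Module.finrank_fin_fun, inv_pow, inv_inv, abs_of_pos (by positivity),
    ENNReal.ofReal_pow ht.le]

lemma norm_smul_floorVec_sub_le {n : ℕ} {t : ℝ} (ht : 0 < t) (x : Fin n → ℝ) :
    ‖t • intVec (floorVec (t⁻¹ • x)) - x‖ ≤ t := by
  refine (pi_norm_le_iff_of_nonneg ht.le).2 fun i => ?_
  have h1 := Int.floor_le (t⁻¹ * x i)
  have h2 := Int.lt_floor_add_one (t⁻¹ * x i)
  have h3 : t * (t⁻¹ * x i) = x i := by field_simp
  simp only [Pi.sub_apply, Pi.smul_apply, smul_eq_mul, intVec, floorVec, Real.norm_eq_abs]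
  rw [abs_le]
  constructor <;> nlinarith [mul_le_mul_of_nonneg_left h1 ht.le, mul_lt_mul_of_pos_left h2 ht]

/-- The Riemann sum of `φ` over the nonzero points of `tℤⁿ`. -/
def riemannSum {n : ℕ} (φ : (Fin n → ℝ) → ENNReal) (t : ℝ) : ENNReal :=
  ENNReal.ofReal t ^ n * ∑' u : Fin n → ℤ, ({0}ᶜ : Set (Fin n → ℝ)).indicator φ (t • intVec u)

lemma riemannSum_eq_lintegral {n : ℕ} (φ : (Fin n → ℝ) → ENNReal) {t : ℝ} (ht : 0 < t) :
    riemannSum φ t = ∫⁻ x, ({0}ᶜ : Set (Fin n → ℝ)).indicator φ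
      (t • intVec (floorVec (t⁻¹ • x))) :=
  (lintegral_floorVec ht fun u => ({0}ᶜ : Set (Fin n → ℝ)).indicator φ (t • intVec u)).symm

lemma one_le_norm_intVec {n : ℕ} {u : Fin n → ℤ} (hu : u ≠ 0) : 1 ≤ ‖intVec u‖ := by
  obtain ⟨i, hi⟩ := Function.ne_iff.1 hu
  refine le_trans ?_ (norm_le_pi_norm (intVec u) i)
  rw [intVec, Real.norm_eq_abs]
  exact_mod_cast Int.one_le_abs hi

lemma riemannSum_le {n : ℕ} {φ : (Fin n → ℝ) → ENNReal} (h1 : ∀ x, φ x ≤ 1) {X : ℝ}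
    (hX : ∀ x, X < ‖x‖ → φ x = 0) {t : ℝ} (ht : 0 < t) :
    riemannSum φ t ≤ volume (Metric.closedBall (0 : Fin n → ℝ) (X + X)) := by
  rw [riemannSum_eq_lintegral φ ht, ← lintegral_indicator_one Metric.isClosed_closedBall.measurableSet]
  refine lintegral_mono fun x => ?_
  by_cases h : t • intVec (floorVec (t⁻¹ • x)) = 0
  · rw [h]
    simp
  by_cases hn : X < ‖t • intVec (floorVec (t⁻¹ • x))‖
  · rw [Set.indicator_of_mem (by simpa using h), hX _ hn]
    exact zero_le
  push Not at hn
  have hu : floorVec (t⁻¹ • x) ≠ 0 := by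
    intro h0
    apply h
    rw [h0]
    ext i
    simp [intVec]
  have ht' : t ≤ X := by
    refine le_trans ?_ hn
    rw [norm_smul, Real.norm_eq_abs, abs_of_pos ht]
    exact le_mul_of_one_le_right ht.le (one_le_norm_intVec hu)
  rw [Set.indicator_of_mem (by simpa using h), Set.indicator_of_mem]
  · exact h1 _
  · rw [mem_closedBall_zero_iff]
    calc ‖x‖ = ‖t • intVec (floorVec (t⁻¹ • x)) - (t • intVec (floorVec (t⁻¹ • x)) - x)‖ := by
          rw [sub_sub_cancel]
      _ ≤ _ := (norm_sub_le _ _).trans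
          (add_le_add hn ((norm_smul_floorVec_sub_le ht x).trans ht'))

lemma tendsto_riemannSum {n : ℕ} (hn : n ≠ 0) {φ : (Fin n → ℝ) → ENNReal} (hφ : Continuous φ)
    (h1 : ∀ x, φ x ≤ 1) {X : ℝ} (hX : ∀ x, X < ‖x‖ → φ x = 0) :
    Tendsto (riemannSum φ) (𝓝[>] 0) (𝓝 (∫⁻ x, φ x)) := by
  have hpos : ∀ᶠ t : ℝ in 𝓝[>] 0, 0 < t := eventually_mem_nhdsWithin
  have hle : ∀ᶠ t : ℝ in 𝓝[>] 0, t < 1 :=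
    eventually_nhdsWithin_of_eventually_nhds (gt_mem_nhds one_pos)
  have hne : Nonempty (Fin n) := ⟨⟨0, Nat.pos_of_ne_zero hn⟩⟩
  refine Tendsto.congr' (hpos.mono fun t ht => (riemannSum_eq_lintegral φ ht).symm) ?_
  refine tendsto_lintegral_filter_of_dominated_convergence
    ((Metric.closedBall (0 : Fin n → ℝ) (X + 1)).indicator 1) ?_ ?_ ?_ ?_
  · refine Eventually.of_forall fun t => ?_
    exact (measurable_of_countable fun u => ({0}ᶜ : Set (Fin n → ℝ)).indicator φ
      (t • intVec u)).comp (measurable_floorVec.comp (measurable_const_smul _))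
  · filter_upwards [hpos, hle] with t ht ht1
    refine Eventually.of_forall fun x => ?_
    refine (Set.indicator_le_self _ _ _).trans ?_
    by_cases h : X < ‖t • intVec (floorVec (t⁻¹ • x))‖
    · rw [hX _ h]
      exact zero_le
    · rw [Set.indicator_of_mem]
      · exact h1 _
      · rw [mem_closedBall_zero_iff]
        calc ‖x‖ = ‖t • intVec (floorVec (t⁻¹ • x)) - (t • intVec (floorVec (t⁻¹ • x)) - x)‖ := by
              rw [sub_sub_cancel]
          _ ≤ _ := (norm_sub_le _ _).trans
              (add_le_add (not_lt.1 h) ((norm_smul_floorVec_sub_le ht x).trans ht1.le))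
  · rw [lintegral_indicator_one Metric.isClosed_closedBall.measurableSet]
    exact measure_closedBall_lt_top.ne
  · have : ∀ᵐ x : Fin n → ℝ, x ≠ 0 := by
      rw [ae_iff]
      simp
    filter_upwards [this] with x hx
    have hlim : Tendsto (fun t : ℝ => t • intVec (floorVec (t⁻¹ • x))) (𝓝[>] 0) (𝓝 x) := by
      rw [tendsto_iff_norm_sub_tendsto_zero]
      refine squeeze_zero' (Eventually.of_forall fun t => norm_nonneg _)
        (hpos.mono fun t ht => norm_smul_floorVec_sub_le ht x) ?_
      exact tendsto_id.mono_left nhdsWithin_le_nhds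
    refine Tendsto.congr' ?_ ((hφ.tendsto x).comp hlim)
    filter_upwards [hlim.eventually_ne hx] with t ht
    rw [Function.comp_apply, Set.indicator_of_mem (by simpa using ht)]

lemma tsum_mul_inv_pow_ne_top {n : ℕ} (hn : 3 ≤ n) :
    ∑' d : ℕ, (d : ENNReal) * ((d : ENNReal) ^ n)⁻¹ ≠ ⊤ := by
  have hs : Summable fun d : ℕ => 1 / (d : ℝ) ^ 2 := Real.summable_one_div_nat_pow.2 one_lt_two
  refine ne_top_of_le_ne_top hs.tsum_ofReal_ne_top (ENNReal.tsum_le_tsum fun d => ?_)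
  rcases Nat.eq_zero_or_pos d with rfl | hd
  · simp
  have hd' : (0 : ℝ) < d := by exact_mod_cast hd
  have h1 : (1 : ℝ) ≤ d := by exact_mod_cast hd
  rw [← ENNReal.ofReal_natCast, ← ENNReal.ofReal_pow hd'.le,
    ← ENNReal.ofReal_inv_of_pos (by positivity), ← ENNReal.ofReal_mul hd'.le]
  refine ENNReal.ofReal_le_ofReal ?_
  rw [← div_eq_mul_inv, div_le_div_iff₀ (by positivity) (by positivity), one_mul, ← pow_succ']
  exact pow_le_pow_right₀ h1 hn

lemma tendsto_tsum_riemannSum {n : ℕ} (hn : 3 ≤ n) {φ : (Fin n → ℝ) → ENNReal} (hφ : Continuous φ)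
    (h1 : ∀ x, φ x ≤ 1) {X : ℝ} (hX : ∀ x, X < ‖x‖ → φ x = 0) :
    Tendsto (fun t : ℝ => ∑' d : ℕ, (d : ENNReal) * ((d : ENNReal) ^ n)⁻¹ * riemannSum φ (d * t))
      (𝓝[>] 0) (𝓝 ((∑' d : ℕ, (d : ENNReal) * ((d : ENNReal) ^ n)⁻¹) * ∫⁻ x, φ x)) := by
  have hpos : ∀ᶠ t : ℝ in 𝓝[>] 0, 0 < t := eventually_mem_nhdsWithin
  have hK : volume (Metric.closedBall (0 : Fin n → ℝ) (X + X)) ≠ ⊤ := measure_closedBall_lt_top.ne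
  have hc : ∀ d : ℕ, (d : ENNReal) * ((d : ENNReal) ^ n)⁻¹ ≠ ⊤ := fun d =>
    ne_top_of_le_ne_top (tsum_mul_inv_pow_ne_top hn) (ENNReal.le_tsum d)
  rw [← ENNReal.tsum_mul_right]
  simp_rw [← lintegral_count]
  refine tendsto_lintegral_filter_of_dominated_convergence
    (fun d : ℕ => (d : ENNReal) * ((d : ENNReal) ^ n)⁻¹
      * volume (Metric.closedBall (0 : Fin n → ℝ) (X + X)))
    (Eventually.of_forall fun t => measurable_of_countable _) ?_ ?_ ?_
  · filter_upwards [hpos] with t ht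
    refine Eventually.of_forall fun d => ?_
    rcases Nat.eq_zero_or_pos d with rfl | hd
    · simp
    · exact mul_le_mul_right (riemannSum_le h1 hX (by positivity)) _
  · rw [lintegral_count, ENNReal.tsum_mul_right]
    exact ENNReal.mul_ne_top (tsum_mul_inv_pow_ne_top hn) hK
  · refine Eventually.of_forall fun d => ?_
    rcases Nat.eq_zero_or_pos d with rfl | hd
    · simp
    refine ENNReal.Tendsto.const_mul ?_ (Or.inr (hc d))
    refine (tendsto_riemannSum (by omega) hφ h1 hX).comp ?_
    refine tendsto_nhdsWithin_iff.2 ⟨?_, hpos.mono fun t ht => ?_⟩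
    · have : Tendsto (fun t : ℝ => (d : ℝ) * t) (𝓝 0) (𝓝 (d * 0)) :=
        (continuous_const_mul (d : ℝ)).tendsto 0
      rw [mul_zero] at this
      exact this.mono_left nhdsWithin_le_nhds
    · exact mul_pos (by exact_mod_cast hd) ht

lemma ofReal_pow_mul_tsum_tsum {n : ℕ} (φ : (Fin n → ℝ) → ENNReal) (t : ℝ) :
    ENNReal.ofReal t ^ n * ∑' d : ℕ, (d : ENNReal) * ∑' u : Fin n → ℤ,
        ({0}ᶜ : Set (Fin n → ℝ)).indicator φ (t • intVec (d • u))
      = ∑' d : ℕ, (d : ENNReal) * ((d : ENNReal) ^ n)⁻¹ * riemannSum φ (d * t) := by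
  rw [← ENNReal.tsum_mul_left]
  refine tsum_congr fun d => ?_
  rcases Nat.eq_zero_or_pos d with rfl | hd
  · simp
  have hd' : (d : ENNReal) ^ n ≠ 0 := pow_ne_zero _ (by exact_mod_cast hd.ne')
  have hdt : (d : ENNReal) ^ n ≠ ⊤ := ENNReal.pow_ne_top (ENNReal.natCast_ne_top d)
  have hv : ∀ u : Fin n → ℤ, t • intVec (d • u) = ((d : ℝ) * t) • intVec u := by
    intro u
    ext i
    simp [intVec]
    ring
  simp_rw [riemannSum, hv]
  rw [ENNReal.ofReal_mul (by positivity), ENNReal.ofReal_natCast, mul_pow, ← mul_assoc, ← mul_assoc,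
    ← mul_assoc, mul_assoc (d : ENNReal) _ ((d : ENNReal) ^ n), ENNReal.inv_mul_cancel hd' hdt,
    mul_one, mul_comm (ENNReal.ofReal t ^ n)]

lemma intCast_zmod_ne_zero {p : ℕ} {z : ℤ} (hz : z ≠ 0) (h : |z| < p) : (z : ZMod p) ≠ 0 := by
  rw [Ne, ZMod.intCast_zmod_eq_zero_iff_dvd]
  exact fun hd => hz (Int.eq_zero_of_abs_lt_dvd hd h)

lemma average_siegel_le {n : ℕ} (hn : 3 ≤ n) (p : ℕ) [Fact p.Prime]
    [Fintype (ℙ (ZMod p) (Fin n → ZMod p))] {f : (Fin n → ℝ) → ℝ} (hf0 : ∀ x, 0 ≤ f x)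
    (hf1 : ∀ x, f x ≤ 1) {X : ℝ} (hX : ∀ x, X < ‖x‖ → f x = 0) (g : SLR n) (I : ℝ)
    (h : ℙ (ZMod p) (Fin n → ZMod p) → SLR n) {ε : ℝ} (hε : 0 < ε) (hε1 : ε ≤ 1)
    (hεp : ε ^ n = (p : ℝ)⁻¹)
    (hh : ∀ (f : (Fin n → ℝ) → ENNReal) x g, siegel f (h x * g) =
        ∑' w : Fin n → ℤ, if modPair p w x.rep = 0 then ({0}ᶜ : Set (Fin n → ℝ)).indicator f
          (ε • Matrix.vecMul (intVec w) (g : Matrix (Fin n) (Fin n) ℝ)) else 0)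
    {K : ℝ} (hK0 : 0 ≤ K)
    (hK : ∀ x, ‖x‖ ≤ K * ‖Matrix.vecMul x (g : Matrix (Fin n) (Fin n) ℝ)‖)
    (hKX : 2 * (K * X) ^ 2 * ε < 1) :
    (Fintype.card (ℙ (ZMod p) (Fin n → ZMod p)) : ENNReal)⁻¹ * ∑ x, ENNReal.ofReal
        (((siegel (fun y => ENNReal.ofReal (f y)) (h x * g)).toReal - I) ^ 2)
      ≤ 2 * (ENNReal.ofReal (((riemannSum (fun y => ENNReal.ofReal (f (Matrix.vecMul y
          (g : Matrix (Fin n) (Fin n) ℝ)))) ε).toReal - I) ^ 2)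
        + 6 * ∑' d : ℕ, (d : ENNReal) * ((d : ENNReal) ^ n)⁻¹ *
          riemannSum (fun y => ENNReal.ofReal (f (Matrix.vecMul y
          (g : Matrix (Fin n) (Fin n) ℝ)))) (d * ε)) := by
  classical
  have hn0 : n ≠ 0 := by omega
  have hp : (0 : ℝ) < p := by exact_mod_cast (Fact.out : p.Prime).pos
  set F : (Fin n → ℤ) → ℝ := fun w => ({0}ᶜ : Set (Fin n → ℝ)).indicator f
    (ε • Matrix.vecMul (intVec w) (g : Matrix (Fin n) (Fin n) ℝ)) with hF
  have hFnn : ∀ w, 0 ≤ F w := fun w => Set.indicator_nonneg (fun x _ => hf0 x) _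
  have hF1 : ∀ w, F w ≤ 1 := fun w => Set.indicator_le' (fun x _ => hf1 x) (fun _ _ => zero_le_one) _
  have hind : ∀ x, ({0}ᶜ : Set (Fin n → ℝ)).indicator (fun y => ENNReal.ofReal (f y)) x
      = ENNReal.ofReal (({0}ᶜ : Set (Fin n → ℝ)).indicator f x) := by
    intro x
    by_cases hx : x ∈ ({0}ᶜ : Set (Fin n → ℝ)) <;> simp [hx]
  have hinj : ∀ x, Matrix.vecMul x (g : Matrix (Fin n) (Fin n) ℝ) = 0 → x = 0 := by
    intro x hx
    have := hK x
    rw [hx, norm_zero, mul_zero] at this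
    exact norm_le_zero_iff.1 this
  have hindg : ∀ u : Fin n → ℤ, ({0}ᶜ : Set (Fin n → ℝ)).indicator (fun y => ENNReal.ofReal
      (f (Matrix.vecMul y (g : Matrix (Fin n) (Fin n) ℝ)))) (ε • intVec u)
      = ENNReal.ofReal (F u) := by
    intro u
    rw [hF]
    dsimp only
    rw [← hind, ← Matrix.smul_vecMul]
    by_cases hu : ε • intVec u = 0
    · simp [hu]
    · have h' : Matrix.vecMul (ε • intVec u) (g : Matrix (Fin n) (Fin n) ℝ) ≠ 0 :=
        fun h0 => hu (hinj _ h0)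
      rw [Set.indicator_of_mem (by simpa using hu), Set.indicator_of_mem (by simpa using h')]
  obtain ⟨B, hB0, hFB, hB⟩ : ∃ B : Finset (Fin n → ℤ), (∀ v ∈ B, v ≠ 0) ∧ (∀ v ∉ B, F v = 0) ∧
      ∀ v ∈ B, ∀ i, |(v i : ℝ)| * ε ≤ K * X := by
    refine ⟨(Finset.Icc (fun _ => -⌊K * X / ε⌋) (fun _ => ⌊K * X / ε⌋)).erase 0,
      fun v hv => Finset.ne_of_mem_erase hv, ?_, ?_⟩
    · intro v hv
      by_contra hne
      apply hv
      have h0 : ε • Matrix.vecMul (intVec v) (g : Matrix (Fin n) (Fin n) ℝ) ≠ 0 := by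
        intro h0
        apply hne
        simp [hF, h0]
      refine Finset.mem_erase.2 ⟨?_, ?_⟩
      · rintro rfl
        apply h0
        have : intVec (0 : Fin n → ℤ) = 0 := by ext i; simp [intVec]
        simp [this]
      · have h1 : ‖ε • Matrix.vecMul (intVec v) (g : Matrix (Fin n) (Fin n) ℝ)‖ ≤ X := by
          by_contra hlt
          apply hne
          rw [hF]
          dsimp only
          rw [Set.indicator_of_mem (by simpa using h0), hX _ (not_le.1 hlt)]
        rw [norm_smul, Real.norm_eq_abs, abs_of_pos hε] at h1
        have h2 : ∀ i, |v i| ≤ ⌊K * X / ε⌋ := by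
          intro i
          rw [Int.le_floor, le_div_iff₀ hε]
          have h3 : |(v i : ℝ)| ≤ ‖intVec v‖ := norm_le_pi_norm (intVec v) i
          have h4 := h3.trans (hK _)
          push_cast
          nlinarith [mul_le_mul_of_nonneg_left h1 hK0, mul_le_mul_of_nonneg_right h4 hε.le]
        exact Finset.mem_Icc.2 ⟨fun i => (abs_le.1 (h2 i)).1, fun i => (abs_le.1 (h2 i)).2⟩
    · intro v hv i
      have h1 := Finset.mem_Icc.1 (Finset.mem_of_mem_erase hv)
      have h2 : |v i| ≤ ⌊K * X / ε⌋ := abs_le.2 ⟨h1.1 i, h1.2 i⟩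
      rw [Int.le_floor, le_div_iff₀ hε] at h2
      exact_mod_cast h2
  have hsmall : ∀ a b : ℝ, 0 ≤ a → 0 ≤ b → a * ε ≤ K * X → b * ε ≤ K * X → 2 * (a * b) < p := by
    intro a b ha hb hae hbe
    have h1 : a * b * ε ^ 2 ≤ (K * X) ^ 2 := by
      have := mul_le_mul hae hbe (by positivity) ((by positivity : 0 ≤ a * ε).trans hae)
      nlinarith
    have h2 : ε ^ n ≤ ε ^ 3 := pow_le_pow_of_le_one hε.le hε1 hn
    have h3 : 2 * (a * b) * ε ^ n < 1 := by
      calc 2 * (a * b) * ε ^ n ≤ 2 * (a * b) * ε ^ 3 := by gcongr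
        _ = 2 * (a * b * ε ^ 2) * ε := by ring
        _ ≤ 2 * (K * X) ^ 2 * ε := by gcongr
        _ < 1 := hKX
    rw [hεp, ← div_eq_mul_inv, div_lt_one hp] at h3
    exact h3
  have habs : ∀ v ∈ B, ∀ w ∈ B, ∀ i j, 2 * (|v i| * |w j|) < (p : ℤ) := by
    intro v hv w hw i j
    exact_mod_cast hsmall _ _ (abs_nonneg _) (abs_nonneg _) (hB v hv i) (hB w hw j)
  have hh1 : ∀ v ∈ B, ∃ i, (v i : ZMod p) ≠ 0 := by
    intro v hv
    obtain ⟨i, hi⟩ := Function.ne_iff.1 (hB0 v hv)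
    refine ⟨i, intCast_zmod_ne_zero hi ?_⟩
    have := habs v hv v hv i i
    have h1 : 1 ≤ |v i| := Int.one_le_abs hi
    nlinarith
  have hh2 : ∀ v ∈ B, ∀ w ∈ B, ¬ Proportional v w →
      ∃ i j, (v i * w j - v j * w i : ZMod p) ≠ 0 := by
    intro v hv w hw hP
    rw [Proportional] at hP
    push Not at hP
    obtain ⟨i, j, hij⟩ := hP
    refine ⟨i, j, ?_⟩
    have : ((v i * w j - v j * w i : ℤ) : ZMod p) ≠ 0 := by
      refine intCast_zmod_ne_zero (sub_ne_zero.2 hij) ((abs_sub _ _).trans_lt ?_)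
      rw [abs_mul, abs_mul]
      linarith [habs v hv w hw i j, habs v hv w hw j i]
    exact_mod_cast this
  have hS : ∀ x, (siegel (fun y => ENNReal.ofReal (f y)) (h x * g)).toReal
      = ∑ v ∈ B, if modPair p v x.rep = 0 then F v else 0 := by
    intro x
    rw [hh]
    simp_rw [hind]
    rw [tsum_eq_sum (s := B), ENNReal.toReal_sum]
    · refine Finset.sum_congr rfl fun v _ => ?_
      split_ifs
      · exact ENNReal.toReal_ofReal (hFnn v)
      · rfl
    · intro v _
      split_ifs <;> simp
    · intro v hv
      have := hFB v hv
      rw [hF] at this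
      dsimp only at this
      rw [this]
      simp
  have hsumF : ENNReal.ofReal ε ^ n * ∑' u, ENNReal.ofReal (F u)
      = ENNReal.ofReal ((∑ v ∈ B, F v) / p) := by
    rw [tsum_eq_sum (s := B) fun v hv => by rw [hFB v hv, ENNReal.ofReal_zero],
      ← ENNReal.ofReal_sum_of_nonneg fun v _ => hFnn v, ← ENNReal.ofReal_pow hε.le, hεp,
      ← ENNReal.ofReal_mul (by positivity), div_eq_inv_mul]
  have hR : (riemannSum (fun y => ENNReal.ofReal (f (Matrix.vecMul y
      (g : Matrix (Fin n) (Fin n) ℝ)))) ε).toReal = (∑ v ∈ B, F v) / p := by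
    rw [riemannSum]
    simp_rw [hindg]
    rw [hsumF, ENNReal.toReal_ofReal (div_nonneg (Finset.sum_nonneg fun v _ => hFnn v) hp.le)]
  have hgcd : ENNReal.ofReal ((p : ℝ)⁻¹ * ∑ v ∈ B, (Finset.univ.gcd v).natAbs * F v)
      ≤ ∑' d : ℕ, (d : ENNReal) * ((d : ENNReal) ^ n)⁻¹ *
          riemannSum (fun y => ENNReal.ofReal (f (Matrix.vecMul y
          (g : Matrix (Fin n) (Fin n) ℝ)))) (d * ε) := by
    rw [← ofReal_pow_mul_tsum_tsum]
    simp_rw [hindg]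
    rw [ENNReal.ofReal_mul (by positivity), ← hεp, ENNReal.ofReal_pow hε.le,
      ENNReal.ofReal_sum_of_nonneg fun v _ => mul_nonneg (Nat.cast_nonneg _) (hFnn v)]
    refine mul_le_mul_right ((le_of_eq ?_).trans ((ENNReal.sum_le_tsum B).trans
      (tsum_gcd_mul_le fun v => ENNReal.ofReal (F v)))) _
    refine Finset.sum_congr rfl fun v _ => ?_
    rw [ENNReal.ofReal_mul (Nat.cast_nonneg _), ENNReal.ofReal_natCast]
  have hne : Nonempty (Fin n) := ⟨⟨0, Nat.pos_of_ne_zero hn0⟩⟩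
  have hcard : (0 : ℝ) < Fintype.card (ℙ (ZMod p) (Fin n → ZMod p)) := by
    exact_mod_cast Fintype.card_pos
  have key : (Fintype.card (ℙ (ZMod p) (Fin n → ZMod p)) : ℝ)⁻¹ *
        ∑ x : ℙ (ZMod p) (Fin n → ZMod p),
          ((∑ v ∈ B, if modPair p v x.rep = 0 then F v else 0) - I) ^ 2
      ≤ 2 * (((∑ v ∈ B, F v) / p - I) ^ 2
        + 6 * ((p : ℝ)⁻¹ * ∑ v ∈ B, (Finset.univ.gcd v).natAbs * F v)) := by
    refine (average_projectivization_le hn0 p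
      (fun a => ((∑ v ∈ B, if modPair p v a = 0 then F v else 0) - I) ^ 2)
      (fun a => sq_nonneg _) ?_).trans ?_
    · intro c a
      simp [Units.smul_def, modPair_smul]
    · refine mul_le_mul_of_nonneg_left ((sum_sq_modPair_le p B F hFnn I hh1 hh2).trans ?_) two_pos.le
      refine add_le_add le_rfl ?_
      rw [mul_left_comm]
      exact mul_le_mul_of_nonneg_left (sum_proportional_le B hB0 F hFnn hF1) (by positivity)
  simp_rw [hS]
  rw [hR, ← ENNReal.ofReal_sum_of_nonneg fun _ _ => sq_nonneg _, ← ENNReal.ofReal_natCast,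
    ← ENNReal.ofReal_inv_of_pos hcard, ← ENNReal.ofReal_mul (by positivity)]
  refine (ENNReal.ofReal_le_ofReal key).trans ?_
  have hg0 : 0 ≤ (p : ℝ)⁻¹ * ∑ v ∈ B, (Finset.univ.gcd v).natAbs * F v :=
    mul_nonneg (by positivity) (Finset.sum_nonneg fun v _ => mul_nonneg (Nat.cast_nonneg _) (hFnn v))
  rw [ENNReal.ofReal_mul two_pos.le, ENNReal.ofReal_add (sq_nonneg _) (by positivity),
    ENNReal.ofReal_mul (by norm_num)]
  simp only [ENNReal.ofReal_ofNat]
  gcongr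

lemma exists_norm_le_mul_norm_vecMul {n : ℕ} (g : SLR n) :
    ∃ K : ℝ, 0 ≤ K ∧ ∀ x, ‖x‖ ≤ K * ‖Matrix.vecMul x (g : Matrix (Fin n) (Fin n) ℝ)‖ := by
  let L := LinearMap.toContinuousLinearMap
    (Matrix.vecMulLinear ((g⁻¹ : SLR n) : Matrix (Fin n) (Fin n) ℝ))
  refine ⟨‖L‖, norm_nonneg _, fun x => ?_⟩
  have h := L.le_opNorm (Matrix.vecMul x (g : Matrix (Fin n) (Fin n) ℝ))
  have hx : L (Matrix.vecMul x (g : Matrix (Fin n) (Fin n) ℝ)) = x := by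
    change Matrix.vecMul (Matrix.vecMul x (g : Matrix (Fin n) (Fin n) ℝ)) _ = x
    rw [Matrix.vecMul_vecMul, ← Matrix.SpecialLinearGroup.coe_mul, mul_inv_cancel,
      Matrix.SpecialLinearGroup.coe_one, Matrix.vecMul_one]
  rwa [hx] at h

lemma continuous_vecMul_coe {n : ℕ} (g : SLR n) :
    Continuous fun x => Matrix.vecMul x (g : Matrix (Fin n) (Fin n) ℝ) :=
  continuous_id.matrix_vecMul continuous_const

lemma lintegral_comp_vecMul {n : ℕ} (g : SLR n) {φ : (Fin n → ℝ) → ENNReal} (hφ : Measurable φ) :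
    ∫⁻ x, φ (Matrix.vecMul x (g : Matrix (Fin n) (Fin n) ℝ)) = ∫⁻ x, φ x := by
  have h := Real.map_matrix_volume_pi_eq_smul_volume_pi
    (M := (g : Matrix (Fin n) (Fin n) ℝ).transpose) (by simp)
  have he : ⇑(Matrix.toLin' (g : Matrix (Fin n) (Fin n) ℝ).transpose)
      = fun x => Matrix.vecMul x (g : Matrix (Fin n) (Fin n) ℝ) := by
    ext1 x
    rw [Matrix.toLin'_apply, Matrix.mulVec_transpose]
  rw [he] at h
  rw [← lintegral_map hφ (continuous_vecMul_coe g).measurable, h]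
  simp

lemma setLIntegral_siegel_sub_sq_le {n : ℕ} (hn : 3 ≤ n) (μ : Measure (SLR n)) [μ.IsHaarMeasure]
    {F : Set (SLR n)} (hF : IsFundamentalDomain (Gam n) F μ) (hF1 : μ F = 1)
    {f : (Fin n → ℝ) → ℝ} (hf : Continuous f) (hf0 : ∀ x, 0 ≤ f x) (hf1 : ∀ x, f x ≤ 1)
    {X : ℝ} (hX : ∀ x, X < ‖x‖ → f x = 0) :
    ∫⁻ g in F, ENNReal.ofReal
        (((siegel (fun y => ENNReal.ofReal (f y)) g).toReal - ∫ x, f x) ^ 2) ∂μ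
      ≤ 12 * (∑' d : ℕ, (d : ENNReal) * ((d : ENNReal) ^ n)⁻¹) * ENNReal.ofReal (∫ x, f x) + 1 := by
  have hn0 : n ≠ 0 := by omega
  have hne : Nonempty (Fin n) := ⟨⟨0, Nat.pos_of_ne_zero hn0⟩⟩
  have hfc : HasCompactSupport f := by
    refine HasCompactSupport.intro (isCompact_closedBall (0 : Fin n → ℝ) X) fun x hx => hX x ?_
    simpa using hx
  have hfm : Measurable fun y => ENNReal.ofReal (f y) := hf.measurable.ennreal_ofReal
  have hintegrable : ∫⁻ x, ENNReal.ofReal (f x) = ENNReal.ofReal (∫ x, f x) :=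
    (ofReal_integral_eq_lintegral_ofReal (hf.integrable_of_hasCompactSupport hfc)
      (Eventually.of_forall hf0)).symm
  choose p hpk hp using Nat.exists_infinite_primes
  have hfact : ∀ k, Fact (p k).Prime := fun k => ⟨hp k⟩
  let _ : ∀ k, Fintype (ℙ (ZMod (p k)) (Fin n → ZMod (p k))) := fun k => Fintype.ofFinite _
  choose h hh1 hh2 using fun k => exists_hecke_average hn0 (p k)
  have hpos : ∀ k, (0 : ℝ) < p k := fun k => by exact_mod_cast (hp k).pos
  set ε : ℕ → ℝ := fun k => (p k : ℝ) ^ (-(n : ℝ)⁻¹) with hεdef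
  have hε : ∀ k, 0 < ε k := fun k => Real.rpow_pos_of_pos (hpos k) _
  have hεp : ∀ k, ε k ^ n = (p k : ℝ)⁻¹ := fun k => by
    rw [hεdef]
    dsimp only
    rw [← Real.rpow_mul_natCast (hpos k).le, neg_mul,
      inv_mul_cancel₀ (by exact_mod_cast hn0), Real.rpow_neg_one]
  have hlim : Tendsto ε atTop (𝓝[>] 0) := by
    refine tendsto_nhdsWithin_iff.2 ⟨?_, Eventually.of_forall hε⟩
    refine (tendsto_rpow_neg_atTop (by positivity : (0 : ℝ) < (n : ℝ)⁻¹)).comp ?_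
    exact tendsto_natCast_atTop_atTop.comp (tendsto_atTop_mono hpk tendsto_id)
  refine setLIntegral_le_of_eventually_average_le μ hF1 h _ ?_ ?_ _ ?_
  · exact (((measurable_siegel hfm).ennreal_toReal.sub_const _).pow_const 2).ennreal_ofReal
  · intro T k
    rw [← tsum_fintype (L := .unconditional _), hh1 k μ F hF fun g => min (ENNReal.ofReal
      (((siegel (fun y => ENNReal.ofReal (f y)) g).toReal - ∫ x, f x) ^ 2)) T,
      Nat.card_eq_fintype_card]
    intro γ g
    rw [siegel_mul_left]
  · intro g
    obtain ⟨K, hK0, hK⟩ := exists_norm_le_mul_norm_vecMul g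
    set φ : (Fin n → ℝ) → ENNReal := fun y => ENNReal.ofReal
      (f (Matrix.vecMul y (g : Matrix (Fin n) (Fin n) ℝ))) with hφ
    have hφc : Continuous φ :=
      ENNReal.continuous_ofReal.comp (hf.comp (continuous_vecMul_coe g))
    have hφ1 : ∀ x, φ x ≤ 1 := fun x => by
      rw [hφ, ← ENNReal.ofReal_one]
      exact ENNReal.ofReal_le_ofReal (hf1 _)
    have hφX : ∀ x, K * X < ‖x‖ → φ x = 0 := fun x hx => by
      rw [hφ]
      dsimp only
      rw [hX _ (lt_of_mul_lt_mul_left (hx.trans_le (hK x)) hK0), ENNReal.ofReal_zero]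
    have hφI : ∫⁻ x, φ x = ENNReal.ofReal (∫ x, f x) :=
      (lintegral_comp_vecMul g hfm).trans hintegrable
    have hI : (0 : ℝ) ≤ ∫ x, f x := integral_nonneg hf0
    have l1 := (tendsto_riemannSum hn0 hφc hφ1 hφX).comp hlim
    have l2 := (tendsto_tsum_riemannSum hn hφc hφ1 hφX).comp hlim
    rw [hφI] at l1 l2
    have l3 : Tendsto (fun k => ENNReal.ofReal (((riemannSum φ (ε k)).toReal - ∫ x, f x) ^ 2))
        atTop (𝓝 0) := by
      have := ENNReal.tendsto_ofReal
        ((((ENNReal.tendsto_toReal ENNReal.ofReal_ne_top).comp l1).sub_const (∫ x, f x)).pow 2)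
      simpa [ENNReal.toReal_ofReal hI] using this
    have l4 : Tendsto (fun k => 2 * (ENNReal.ofReal (((riemannSum φ (ε k)).toReal - ∫ x, f x) ^ 2)
        + 6 * ∑' d : ℕ, (d : ENNReal) * ((d : ENNReal) ^ n)⁻¹ * riemannSum φ (d * ε k))) atTop
        (𝓝 (2 * (0 + 6 * ((∑' d : ℕ, (d : ENNReal) * ((d : ENNReal) ^ n)⁻¹)
          * ENNReal.ofReal (∫ x, f x))))) :=
      ENNReal.Tendsto.const_mul (l3.add (ENNReal.Tendsto.const_mul l2 (Or.inr (by simp))))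
        (Or.inr (by simp))
    have hfin : (∑' d : ℕ, (d : ENNReal) * ((d : ENNReal) ^ n)⁻¹) * ENNReal.ofReal (∫ x, f x) ≠ ⊤ :=
      ENNReal.mul_ne_top (tsum_mul_inv_pow_ne_top hn) ENNReal.ofReal_ne_top
    have e1 : ∀ᶠ k in atTop, ε k ≤ 1 :=
      ((tendsto_nhdsWithin_iff.1 hlim).1.eventually_lt_const one_pos).mono fun k hk => hk.le
    have e2 : ∀ᶠ k in atTop, 2 * (K * X) ^ 2 * ε k < 1 := by
      have := (tendsto_nhdsWithin_iff.1 hlim).1.const_mul (2 * (K * X) ^ 2)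
      rw [mul_zero] at this
      exact this.eventually_lt_const one_pos
    have hlt : 2 * (0 + 6 * ((∑' d : ℕ, (d : ENNReal) * ((d : ENNReal) ^ n)⁻¹)
          * ENNReal.ofReal (∫ x, f x)))
        < 12 * (∑' d : ℕ, (d : ENNReal) * ((d : ENNReal) ^ n)⁻¹) * ENNReal.ofReal (∫ x, f x) + 1 := by
      rw [zero_add, ← mul_assoc, mul_assoc 12]
      norm_num
      exact ENNReal.lt_add_right (ENNReal.mul_ne_top (by simp) hfin) one_ne_zero
    filter_upwards [e1, e2, l4.eventually_lt_const hlt] with k hk1 hk2 hk3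
    exact (average_siegel_le hn (p k) hf0 hf1 hX g _ (h k) (hε k) hk1 (hεp k) (hh2 k) hK0 hK
      hk2).trans hk3.le

lemma siegel_eq_riemannSum {n : ℕ} (f : (Fin n → ℝ) → ENNReal) (g : SLR n) :
    siegel f g
      = riemannSum (fun y => f (Matrix.vecMul y (g : Matrix (Fin n) (Fin n) ℝ))) 1 := by
  obtain ⟨K, hK0, hK⟩ := exists_norm_le_mul_norm_vecMul g
  rw [siegel, riemannSum, ENNReal.ofReal_one, one_pow, one_mul]
  refine tsum_congr fun u => ?_
  rw [one_smul]
  by_cases hu : intVec u = 0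
  · simp [hu]
  · have h' : Matrix.vecMul (intVec u) (g : Matrix (Fin n) (Fin n) ℝ) ≠ 0 := fun h0 => hu (by
      have := hK (intVec u)
      rw [h0, norm_zero, mul_zero] at this
      exact norm_le_zero_iff.1 this)
    rw [Set.indicator_of_mem (by simpa using h'), Set.indicator_of_mem (by simpa using hu)]

lemma siegel_ne_top {n : ℕ} {f : (Fin n → ℝ) → ENNReal} (hf1 : ∀ x, f x ≤ 1) {X : ℝ}
    (hX : ∀ x, X < ‖x‖ → f x = 0) (g : SLR n) : siegel f g ≠ ⊤ := by
  obtain ⟨K, hK0, hK⟩ := exists_norm_le_mul_norm_vecMul g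
  rw [siegel_eq_riemannSum]
  refine ne_top_of_le_ne_top measure_closedBall_lt_top.ne
    (riemannSum_le (X := K * X) (fun x => hf1 _) (fun x hx => ?_) one_pos)
  exact hX _ (lt_of_mul_lt_mul_left (hx.trans_le (hK x)) hK0)

lemma siegel_mono {n : ℕ} {f₁ f₂ : (Fin n → ℝ) → ENNReal} (h : ∀ x, f₁ x ≤ f₂ x) (g : SLR n) :
    siegel f₁ g ≤ siegel f₂ g :=
  ENNReal.tsum_le_tsum fun _ => Set.indicator_le_indicator (h _)

lemma siegel_add {n : ℕ} (f₁ f₂ : (Fin n → ℝ) → ENNReal) (g : SLR n) :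
    siegel (fun x => f₁ x + f₂ x) g = siegel f₁ g + siegel f₂ g := by
  rw [siegel, siegel, siegel, ← ENNReal.tsum_add]
  exact tsum_congr fun v => congrFun (Set.indicator_add _ f₁ f₂) _

lemma tendsto_siegel {n : ℕ} {f : ℕ → (Fin n → ℝ) → ENNReal} {F : (Fin n → ℝ) → ENNReal}
    (hle : ∀ k x, f k x ≤ F x) (hlim : ∀ x, Tendsto (fun k => f k x) atTop (𝓝 (F x)))
    (g : SLR n) (hF : siegel F g ≠ ⊤) :
    Tendsto (fun k => siegel (f k) g) atTop (𝓝 (siegel F g)) := by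
  rw [siegel] at hF
  simp_rw [siegel, ← lintegral_count] at hF ⊢
  refine tendsto_lintegral_filter_of_dominated_convergence _
    (Eventually.of_forall fun k => measurable_of_countable _)
    (Eventually.of_forall fun k => Eventually.of_forall fun v =>
      Set.indicator_le_indicator (hle k _)) hF (Eventually.of_forall fun v => ?_)
  by_cases hv : Matrix.vecMul (intVec v) (g : Matrix (Fin n) (Fin n) ℝ)
      ∈ ({0}ᶜ : Set (Fin n → ℝ))
  · simp only [Set.indicator_of_mem hv]
    exact hlim _
  · simp only [Set.indicator_of_notMem hv]
    exact tendsto_const_nhds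

/-- The second moment of the number of nonzero lattice points in a bounded open set of volume at
most one. -/
lemma setLIntegral_siegel_indicator_sq_le {n : ℕ} (hn : 3 ≤ n) (μ : Measure (SLR n))
    [μ.IsHaarMeasure] {F : Set (SLR n)} (hF : IsFundamentalDomain (Gam n) F μ) (hF1 : μ F = 1)
    {U : Set (Fin n → ℝ)} (hU : IsOpen U) {X : ℝ} (hX : ∀ x ∈ U, ‖x‖ ≤ X) (hU1 : volume U ≤ 1) :
    ∫⁻ g in F, siegel (U.indicator 1) g ^ 2 ∂μ
      ≤ 24 * (∑' d : ℕ, (d : ENNReal) * ((d : ENNReal) ^ n)⁻¹) + 4 := by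
  set δ : ℕ → ℝ := fun k => 1 / ((k : ℝ) + 1) with hδ
  have hδ0 : ∀ k, 0 < δ k := fun k => by positivity
  set f : ℕ → (Fin n → ℝ) → ℝ := fun k x => 1 - (thickenedIndicator (hδ0 k) Uᶜ x : ℝ) with hfdef
  have hfc : ∀ k, Continuous (f k) := fun k =>
    continuous_const.sub (NNReal.continuous_coe.comp (thickenedIndicator (hδ0 k) Uᶜ).continuous)
  have hf0 : ∀ k x, 0 ≤ f k x := fun k x => sub_nonneg.2 (by
    exact_mod_cast thickenedIndicator_le_one (hδ0 k) Uᶜ x)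
  have hf1 : ∀ k x, f k x ≤ 1 := fun k x => sub_le_self _ (NNReal.coe_nonneg _)
  have hfU : ∀ k, ∀ x ∉ U, f k x = 0 := fun k x hx => by
    simp only [hfdef]
    rw [thickenedIndicator_one (hδ0 k) Uᶜ hx]
    simp
  have hfX : ∀ k x, X < ‖x‖ → f k x = 0 := fun k x hx =>
    hfU k x fun hxU => absurd (hX x hxU) (not_le.2 hx)
  have hle : ∀ k x, ENNReal.ofReal (f k x) ≤ U.indicator 1 x := fun k x => by
    by_cases hx : x ∈ U
    · rw [Set.indicator_of_mem hx]
      exact ENNReal.ofReal_le_one.2 (hf1 k x)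
    · rw [hfU k x hx]
      simp
  have hlim : ∀ x, Tendsto (fun k => ENNReal.ofReal (f k x)) atTop (𝓝 (U.indicator 1 x)) := by
    intro x
    have h := tendsto_pi_nhds.1 (thickenedIndicator_tendsto_indicator_closure hδ0
      tendsto_one_div_add_atTop_nhds_zero_nat Uᶜ) x
    rw [hU.isClosed_compl.closure_eq] at h
    have h2 := ENNReal.tendsto_ofReal ((NNReal.tendsto_coe.2 h).const_sub 1)
    convert h2 using 2
    by_cases hx : x ∈ U <;> simp [hx]
  have hSU : ∀ g, siegel (U.indicator 1) g ≠ ⊤ := siegel_ne_top (X := X)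
    (fun x => Set.indicator_le_self' (fun _ _ => zero_le) x)
    (fun x hx => Set.indicator_of_notMem (fun hxU => absurd (hX x hxU) (not_le.2 hx)) _)
  have hfm : ∀ k, Measurable fun x => ENNReal.ofReal (f k x) :=
    fun k => (hfc k).measurable.ennreal_ofReal
  have hintegrable : ∀ k, ENNReal.ofReal (∫ x, f k x) ≤ 1 := by
    intro k
    have hcs : HasCompactSupport (f k) :=
      HasCompactSupport.intro (isCompact_closedBall (0 : Fin n → ℝ) X) fun x hx =>
        hfX k x (by simpa using hx)
    rw [ofReal_integral_eq_lintegral_ofReal ((hfc k).integrable_of_hasCompactSupport hcs)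
      (Eventually.of_forall (hf0 k))]
    refine (lintegral_mono (hle k)).trans ?_
    rwa [lintegral_indicator_one hU.measurableSet]
  have hbound : ∀ k, ∫⁻ g in F, siegel (fun x => ENNReal.ofReal (f k x)) g ^ 2 ∂μ
      ≤ 24 * (∑' d : ℕ, (d : ENNReal) * ((d : ENNReal) ^ n)⁻¹) + 4 := by
    intro k
    have hI0 : 0 ≤ ∫ x, f k x := integral_nonneg (hf0 k)
    have hI1 : ∫ x, f k x ≤ 1 := ENNReal.ofReal_le_one.1 (hintegrable k)
    have hpt : ∀ g, siegel (fun x => ENNReal.ofReal (f k x)) g ^ 2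
        ≤ 2 * ENNReal.ofReal (((siegel (fun x => ENNReal.ofReal (f k x)) g).toReal
          - ∫ x, f k x) ^ 2) + 2 := by
      intro g
      have hfin := ne_top_of_le_ne_top (hSU g) (siegel_mono (hle k) g)
      conv_lhs => rw [← ENNReal.ofReal_toReal hfin]
      rw [← ENNReal.ofReal_pow ENNReal.toReal_nonneg,
        show (2 : ENNReal) = ENNReal.ofReal 2 by simp, ← ENNReal.ofReal_mul two_pos.le,
        ← ENNReal.ofReal_add (by positivity) two_pos.le]
      refine ENNReal.ofReal_le_ofReal ?_
      nlinarith [sq_nonneg ((siegel (fun x => ENNReal.ofReal (f k x)) g).toReal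
          - 2 * ∫ x, f k x)]
    refine (lintegral_mono hpt).trans ?_
    rw [lintegral_add_right _ measurable_const, lintegral_const_mul' _ _ (by simp),
      setLIntegral_const, hF1, mul_one]
    refine (add_le_add_left (mul_le_mul_right (setLIntegral_siegel_sub_sq_le hn μ hF hF1
      (hfc k) (hf0 k) (hf1 k) (hfX k)) 2) 2).trans ?_
    calc _ ≤ 2 * (12 * (∑' d : ℕ, (d : ENNReal) * ((d : ENNReal) ^ n)⁻¹) * 1 + 1) + 2 := by
          gcongr
          exact hintegrable k
      _ = _ := by ring
  calc ∫⁻ g in F, siegel (U.indicator 1) g ^ 2 ∂μ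
      = ∫⁻ g in F, liminf (fun k => siegel (fun x => ENNReal.ofReal (f k x)) g ^ 2) atTop ∂μ :=
        lintegral_congr fun g =>
          (((ENNReal.continuous_pow 2).tendsto _).comp
            (tendsto_siegel hle hlim g (hSU g))).liminf_eq.symm
    _ ≤ liminf (fun k => ∫⁻ g in F, siegel (fun x => ENNReal.ofReal (f k x)) g ^ 2 ∂μ) atTop :=
        lintegral_liminf_le fun k => (measurable_siegel (hfm k)).pow_const 2
    _ ≤ liminf (fun _ : ℕ => 24 * (∑' d : ℕ, (d : ENNReal) * ((d : ENNReal) ^ n)⁻¹) + 4) atTop :=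
        liminf_le_liminf (Eventually.of_forall hbound)
    _ = _ := liminf_const _

lemma abs_latCount_sub_siegel_le {n : ℕ} {A : Set (Fin n → ℝ)} (hA : Bornology.IsBounded A)
    (g : SLR n) : |(latCount g A : ℝ) - (siegel (A.indicator 1) g).toReal| ≤ 1 := by
  set T : Set (Fin n → ℤ) :=
    {v | Matrix.vecMul (intVec v) (g : Matrix (Fin n) (Fin n) ℝ) ∈ A} with hT
  obtain ⟨X, hX⟩ := hA.exists_norm_le
  have hS : siegel (A.indicator 1) g ≠ ⊤ := siegel_ne_top (X := X)
    (fun x => Set.indicator_le_self' (fun _ _ => zero_le) x)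
    (fun x hx => Set.indicator_of_notMem (fun hxA => absurd (hX x hxA) (not_le.2 hx)) _) g
  have hsum : Measure.count T
      = ∑' v : Fin n → ℤ, A.indicator (1 : (Fin n → ℝ) → ENNReal)
        (Matrix.vecMul (intVec v) (g : Matrix (Fin n) (Fin n) ℝ)) := by
    rw [← lintegral_indicator_one T.to_countable.measurableSet, lintegral_count]
    rfl
  have hlow : siegel (A.indicator 1) g ≤ Measure.count T := by
    rw [hsum]
    exact ENNReal.tsum_le_tsum fun v => Set.indicator_le_self _ _ _
  have hupp : Measure.count T ≤ siegel (A.indicator 1) g + 1 := by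
    rw [hsum, siegel, ← tsum_pi_single (0 : Fin n → ℤ) (1 : ENNReal), ← ENNReal.tsum_add]
    refine ENNReal.tsum_le_tsum fun v => ?_
    by_cases hv : v = 0
    · subst hv
      rw [Pi.single_eq_same]
      exact (Set.indicator_le_self' (fun _ _ => zero_le) _).trans le_add_self
    · obtain ⟨K, -, hK⟩ := exists_norm_le_mul_norm_vecMul g
      have h' : Matrix.vecMul (intVec v) (g : Matrix (Fin n) (Fin n) ℝ)
          ∈ ({0}ᶜ : Set (Fin n → ℝ)) := fun h0 => by
        have h1 := hK (intVec v)
        rw [Set.mem_singleton_iff.1 h0, norm_zero, mul_zero] at h1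
        linarith [one_le_norm_intVec hv]
      rw [Set.indicator_of_mem h']
      exact le_self_add
  have hfin : T.Finite := Measure.count_apply_lt_top.1
    (hupp.trans_lt (ENNReal.add_lt_top.2 ⟨hS.lt_top, ENNReal.one_lt_top⟩))
  have hcount : Measure.count T = (latCount g A : ENNReal) := by
    rw [Measure.count_apply_finite T hfin, latCount, Nat.card_eq_card_finite_toFinset hfin]
  rw [hcount] at hlow hupp
  have h1 := ENNReal.toReal_mono (by simp) hlow
  have h2 := ENNReal.toReal_mono (by simp [hS]) hupp
  rw [ENNReal.toReal_add hS (by simp)] at h2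
  simp only [ENNReal.toReal_natCast, ENNReal.toReal_one] at h1 h2
  rw [abs_le]
  constructor <;> linarith

/-- A bounded measurable set is approximated by a continuous function up to the indicator of an open
set of volume at most one. -/
lemma exists_continuous_near_indicator {n : ℕ} {A : Set (Fin n → ℝ)} (hA : MeasurableSet A)
    (hAb : Bornology.IsBounded A) :
    ∃ (f : (Fin n → ℝ) → ℝ) (W : Set (Fin n → ℝ)) (X : ℝ), Continuous f ∧ (∀ x, 0 ≤ f x) ∧
      (∀ x, f x ≤ 1) ∧ (∀ x, X < ‖x‖ → f x = 0) ∧ IsOpen W ∧ (∀ x ∈ W, ‖x‖ ≤ X) ∧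
      volume W ≤ 1 ∧
      (∀ x, A.indicator (1 : (Fin n → ℝ) → ENNReal) x ≤ ENNReal.ofReal (f x) + W.indicator 1 x) ∧
      (∀ x, ENNReal.ofReal (f x) ≤ A.indicator 1 x + W.indicator 1 x) := by
  have hAtop : volume A ≠ ⊤ := hAb.measure_lt_top.ne
  obtain ⟨X, hX⟩ := hAb.exists_norm_le
  obtain ⟨U, hAU, hU, -, hUA⟩ := hA.exists_isOpen_sdiff_lt hAtop (ε := 2⁻¹) (by simp)
  obtain ⟨K, hKA, hK, hAK⟩ := hA.exists_isCompact_sdiff_lt hAtop (ε := 2⁻¹) (by simp)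
  set U' := U ∩ Metric.ball 0 (X + 1) with hU'
  have hAU' : A ⊆ U' := fun x hx => ⟨hAU hx, by simpa using (hX x hx).trans_lt (lt_add_one X)⟩
  have hU'o : IsOpen U' := hU.inter Metric.isOpen_ball
  obtain ⟨f, hf1, hf0, -, hf⟩ := exists_continuous_one_zero_of_isCompact hK hU'o.isClosed_compl
    (Set.disjoint_compl_right_iff_subset.2 (hKA.trans hAU'))
  have hfU : ∀ x ∉ U', f x = 0 := fun x hx => hf0 hx
  refine ⟨f, U' \ K, X + 1, f.continuous, fun x => (hf x).1, fun x => (hf x).2, fun x hx =>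
    hfU x fun h => ?_, hU'o.sdiff hK.isClosed, fun x hx => ?_, ?_, fun x => ?_, fun x => ?_⟩
  · have := h.2
    rw [mem_ball_zero_iff] at this
    exact absurd this (not_lt.2 hx.le)
  · exact (mem_ball_zero_iff.1 hx.1.2).le
  · calc volume (U' \ K) ≤ volume ((U \ A) ∪ (A \ K)) := measure_mono fun x hx => by
          by_cases h : x ∈ A
          · exact Or.inr ⟨h, hx.2⟩
          · exact Or.inl ⟨hx.1.1, h⟩
      _ ≤ 2⁻¹ + 2⁻¹ := (measure_union_le _ _).trans (add_le_add hUA.le hAK.le)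
      _ = 1 := ENNReal.inv_two_add_inv_two
  · by_cases hxA : x ∈ A
    · by_cases hxK : x ∈ K
      · rw [show f x = 1 from hf1 hxK, ENNReal.ofReal_one]
        exact (Set.indicator_le_self' (fun _ _ => zero_le) _).trans le_self_add
      · rw [Set.indicator_of_mem (show x ∈ U' \ K from ⟨hAU' hxA, hxK⟩)]
        exact (Set.indicator_le_self' (fun _ _ => zero_le) _).trans le_add_self
    · simp [hxA]
  · by_cases hxU : x ∈ U'
    · have h1 : ENNReal.ofReal (f x) ≤ 1 := ENNReal.ofReal_le_one.2 (hf x).2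
      by_cases hxK : x ∈ K
      · rw [Set.indicator_of_mem (hKA hxK)]
        exact h1.trans le_self_add
      · rw [Set.indicator_of_mem (show x ∈ U' \ K from ⟨hxU, hxK⟩)]
        exact h1.trans le_add_self
    · rw [hfU x hxU]
      simp

lemma setLIntegral_disc_sq_le {n : ℕ} (hn : 3 ≤ n) (μ : Measure (SLR n)) [μ.IsHaarMeasure]
    {F : Set (SLR n)} (hF : IsFundamentalDomain (Gam n) F μ) (hF1 : μ F = 1)
    {A : Set (Fin n → ℝ)} (hA : MeasurableSet A) (hAb : Bornology.IsBounded A) :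
    ∫⁻ g in F, ENNReal.ofReal (disc g A ^ 2) ∂μ
      ≤ 27 + 36 * (∑' d : ℕ, (d : ENNReal) * ((d : ENNReal) ^ n)⁻¹) * (volume A + 3) := by
  obtain ⟨f, W, X, hfc, hf0, hf1, hfX, hW, hWX, hW1, hAf, hfA⟩ :=
    exists_continuous_near_indicator hA hAb
  have hAtop : volume A ≠ ⊤ := hAb.measure_lt_top.ne
  have hWtop : volume W ≠ ⊤ := ne_top_of_le_ne_top ENNReal.one_ne_top hW1
  have hcs : HasCompactSupport f :=
    HasCompactSupport.intro (isCompact_closedBall (0 : Fin n → ℝ) X) fun x hx =>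
      hfX x (by simpa using hx)
  have hI := ofReal_integral_eq_lintegral_ofReal (μ := volume) (hfc.integrable_of_hasCompactSupport hcs)
      (Eventually.of_forall hf0)
  have hI0 : 0 ≤ ∫ x, f x := integral_nonneg hf0
  have hind : ∀ {B : Set (Fin n → ℝ)}, MeasurableSet B →
      Measurable (B.indicator (1 : (Fin n → ℝ) → ENNReal)) := fun hB => measurable_one.indicator hB
  have hVI : volume A ≤ ENNReal.ofReal (∫ x, f x) + 1 := by
    rw [hI, ← lintegral_indicator_one hA]
    refine (lintegral_mono hAf).trans ?_
    rw [lintegral_add_right _ (hind hW.measurableSet), lintegral_indicator_one hW.measurableSet]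
    gcongr
  have hIV : ENNReal.ofReal (∫ x, f x) ≤ volume A + 1 := by
    rw [hI, ← lintegral_indicator_one hA]
    refine (lintegral_mono hfA).trans ?_
    rw [lintegral_add_right _ (hind hW.measurableSet), lintegral_indicator_one hW.measurableSet]
    gcongr
  have hVI' := ENNReal.toReal_mono (by simp) hVI
  have hIV' := ENNReal.toReal_mono (by simp [hAtop]) hIV
  rw [ENNReal.toReal_add (by simp) (by simp), ENNReal.toReal_ofReal hI0, ENNReal.toReal_one] at hVI'
  rw [ENNReal.toReal_add hAtop (by simp), ENNReal.toReal_ofReal hI0, ENNReal.toReal_one] at hIV'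
  set S : SLR n → ENNReal := siegel fun x => ENNReal.ofReal (f x) with hS
  have hStop : ∀ g, S g ≠ ⊤ := siegel_ne_top (X := X) (fun x => ENNReal.ofReal_le_one.2 (hf1 x))
    fun x hx => by rw [hfX x hx, ENNReal.ofReal_zero]
  have hSWtop : ∀ g, siegel (W.indicator 1) g ≠ ⊤ := siegel_ne_top (X := X)
    (fun x => Set.indicator_le_self' (fun _ _ => zero_le) x)
    (fun x hx => Set.indicator_of_notMem (fun hxW => absurd (hWX x hxW) (not_le.2 hx)) _)
  have hpt : ∀ g, ENNReal.ofReal (disc g A ^ 2) ≤ 3 * siegel (W.indicator 1) g ^ 2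
      + (3 * ENNReal.ofReal (((S g).toReal - ∫ x, f x) ^ 2) + 12) := by
    intro g
    have hc := abs_le.1 (abs_latCount_sub_siegel_le hAb g)
    have h1 : siegel (A.indicator 1) g ≤ S g + siegel (W.indicator 1) g := by
      rw [hS, ← siegel_add]
      exact siegel_mono hAf g
    have h2 : S g ≤ siegel (A.indicator 1) g + siegel (W.indicator 1) g := by
      rw [hS, ← siegel_add]
      exact siegel_mono hfA g
    have hSA : siegel (A.indicator 1) g ≠ ⊤ :=
      ne_top_of_le_ne_top (ENNReal.add_ne_top.2 ⟨hStop g, hSWtop g⟩) h1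
    have h1' := ENNReal.toReal_mono (ENNReal.add_ne_top.2 ⟨hStop g, hSWtop g⟩) h1
    have h2' := ENNReal.toReal_mono (ENNReal.add_ne_top.2 ⟨hSA, hSWtop g⟩) h2
    rw [ENNReal.toReal_add (hStop g) (hSWtop g)] at h1'
    rw [ENNReal.toReal_add hSA (hSWtop g)] at h2'
    rw [← ENNReal.ofReal_toReal (hSWtop g), ← ENNReal.ofReal_pow ENNReal.toReal_nonneg,
      show (3 : ENNReal) = ENNReal.ofReal 3 by simp,
      show (12 : ENNReal) = ENNReal.ofReal 12 by simp, ← ENNReal.ofReal_mul (by norm_num),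
      ← ENNReal.ofReal_mul (by norm_num), ← ENNReal.ofReal_add (by positivity) (by norm_num),
      ← ENNReal.ofReal_add (by positivity) (by positivity)]
    refine ENNReal.ofReal_le_ofReal ?_
    set w := (siegel (W.indicator 1) g).toReal
    set s := (S g).toReal - ∫ x, f x with hs
    have hw : 0 ≤ w := ENNReal.toReal_nonneg
    have hd : disc g A ≤ 2 + w + |s| := by
      rw [disc, abs_le]
      have := neg_abs_le s
      have := le_abs_self s
      constructor <;> linarith
    have hd0 : 0 ≤ disc g A := abs_nonneg _
    have hs2 := sq_abs s
    nlinarith [pow_le_pow_left₀ hd0 hd 2, sq_nonneg (2 - w), sq_nonneg (2 - |s|),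
      sq_nonneg (w - |s|)]
  have hfm : Measurable fun x => ENNReal.ofReal (f x) := hfc.measurable.ennreal_ofReal
  refine (lintegral_mono hpt).trans ?_
  rw [lintegral_add_left (((measurable_siegel (hind hW.measurableSet)).pow_const 2).const_mul 3),
    lintegral_add_right _ measurable_const, lintegral_const_mul' _ _ (by simp),
    lintegral_const_mul' _ _ (by simp), setLIntegral_const, hF1, mul_one]
  calc _ ≤ 3 * (24 * (∑' d : ℕ, (d : ENNReal) * ((d : ENNReal) ^ n)⁻¹) + 4)
        + (3 * (12 * (∑' d : ℕ, (d : ENNReal) * ((d : ENNReal) ^ n)⁻¹) * (volume A + 1) + 1)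
          + 12) := by
        gcongr
        · exact setLIntegral_siegel_indicator_sq_le hn μ hF hF1 hW hWX hW1
        · refine (setLIntegral_siegel_sub_sq_le hn μ hF hF1 hfc hf0 hf1 hfX).trans ?_
          gcongr
    _ = _ := by ring

/-- Mean square bound for the discrepancy: with Haar measure normalized so that a
fundamental domain for `SL_n(ℤ)` has measure one, the second moment of `D(ℤⁿg, A)` over a
fundamental domain is `O_n(vol A)` for any bounded measurable `A` with `vol(A) > 1`. -/
theorem discrepancy_second_moment
    (n : ℕ) (hn : 3 ≤ n)
    (μ : Measure (SLR n)) [μ.IsHaarMeasure]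
    (hnorm : ∀ F : Set (SLR n), IsFundamentalDomain (Gam n) F μ → μ F = 1) :
    ∃ C > (0 : ℝ), ∀ F : Set (SLR n), IsFundamentalDomain (Gam n) F μ →
      ∀ A : Set (Fin n → ℝ), MeasurableSet A → Bornology.IsBounded A →
        1 < (volume A).toReal →
        ∫ g in F, (disc g A) ^ 2 ∂μ ≤ C * (volume A).toReal := by
  have hC := tsum_mul_inv_pow_ne_top hn
  set c := ∑' d : ℕ, (d : ENNReal) * ((d : ENNReal) ^ n)⁻¹
  have hc : 0 ≤ c.toReal := ENNReal.toReal_nonneg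
  refine ⟨27 + 144 * c.toReal, by positivity, fun F hF A hA hAb hA1 => ?_⟩
  have hAtop : volume A ≠ ⊤ := hAb.measure_lt_top.ne
  have hbound := ENNReal.toReal_mono (by finiteness)
    (setLIntegral_disc_sq_le hn μ hF (hnorm F hF) hA hAb)
  rw [ENNReal.toReal_add (by finiteness) (by finiteness), ENNReal.toReal_mul, ENNReal.toReal_mul,
    ENNReal.toReal_add hAtop (by finiteness)] at hbound
  simp only [ENNReal.toReal_ofNat] at hbound
  by_cases hintegrable : Integrable (fun g => disc g A ^ 2) (μ.restrict F)
  · rw [integral_eq_lintegral_of_nonneg_ae (Eventually.of_forall fun g => sq_nonneg _)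
      hintegrable.aestronglyMeasurable]
    refine hbound.trans ?_
    nlinarith [mul_le_mul_of_nonneg_left hA1.le hc]
  · rw [integral_undef hintegrable]
    positivity

end
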